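/- Let d ≥ 2 and k ≥ 1 be integers with k < 2d−1 and let 0 < ε < 1. For i = 1,…,d let J_i := [(2i−2)/(2d−1), (2i−1)/(2d−1)], and define f on ⋃ J_i by f(x) := A·((2d−1)x + x^{k+ε}) for x ∈ J_1, where A := (1 + (2d−1)^{−(k+ε)})^{−1}, and f equal on each J_i, i ≥ 2, to the increasing affine map from J_i onto [0,1]. Let g_i := (f restricted to J_i)^{−1} : [0,1] → J_i. Then g_1,…,g_d is a C^{k+ε} Cantor system on [0,1]; its scaling function S exists; and for every ε₁ with ε < ε₁ ≤ 1, S is not the scaling function of any C^{k+ε₁} Cantor system on [0,1] with d branches. -/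

import Mathlib

open Set Filter

noncomputable section

/-- The unit interval `[0,1] ⊆ ℝ`. -/
abbrev I01 : Set ℝ := Set.Icc (0:ℝ) 1

/-- `ψ` satisfies an `ε`-Hölder bound with constant `H` on `[0,1]`. -/
def HolderBoundOn01 (ε H : ℝ) (ψ : ℝ → ℝ) : Prop :=
  ∀ x ∈ I01, ∀ y ∈ I01, |ψ x - ψ y| ≤ H * |x - y| ^ ε

/-- A `C^{k+ε}` Cantor system on `[0,1]` with `d` branches: each branch `g i` is a
`C^k` increasing contraction of `[0,1]` with `ε`-Hölder `k`-th derivative, the images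
`g i ([0,1])` are disjoint closed intervals in increasing order, `g 0 0 = 0` and
`g (d-1) 1 = 1`. -/
structure IsCantorSystem {d : ℕ} (k : ℕ) (ε : ℝ) (g : Fin d → ℝ → ℝ) : Prop where
  maps : ∀ i, Set.MapsTo (g i) I01 I01
  smooth : ∀ i, ContDiffOn ℝ k (g i) I01
  holder : ∀ i, ∃ H > 0, HolderBoundOn01 ε H (iteratedDerivWithin k (g i) I01)
  deriv_pos : ∀ i, ∀ x ∈ I01, 0 < derivWithin (g i) I01 x
  deriv_lt_one : ∀ i, ∀ x ∈ I01, derivWithin (g i) I01 x < 1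
  ordered : ∀ i j : Fin d, i < j → g i 1 < g j 0
  first : ∀ i : Fin d, (i : ℕ) = 0 → g i 0 = 0
  last : ∀ i : Fin d, (i : ℕ) = d - 1 → g i 1 = 1

/-- For a finite word `w = [w₁,…,wₙ]`, `wordMap g w = g_{wₙ} ∘ ⋯ ∘ g_{w₁}` (i.e. `G_w`). -/
def wordMap {d : ℕ} (g : Fin d → ℝ → ℝ) : List (Fin d) → ℝ → ℝ
  | [] => id
  | i :: w => fun x => wordMap g w (g i x)

/-- `|I_w|`, the length of the interval `I_w = G_w([0,1]) = [G_w 0, G_w 1]`. -/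
def wordLen {d : ℕ} (g : Fin d → ℝ → ℝ) (w : List (Fin d)) : ℝ :=
  wordMap g w 1 - wordMap g w 0

/-- The scaling data of the word `w`: the first `d` coordinates are the ratios
`|I_{i·w}|/|I_w|`, the last `d-1` coordinates are the `d-1` gap lengths between the
consecutive children `I_{1·w},…,I_{d·w}` divided by `|I_w|`. -/
def scalingData {d : ℕ} (g : Fin d → ℝ → ℝ) (w : List (Fin d)) : Fin (2*d-1) → ℝ :=
  fun m =>
    if h : (m : ℕ) < d then
      wordLen g ((⟨(m : ℕ), h⟩ : Fin d) :: w) / wordLen g w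
    else
      (wordMap g w (g ⟨(m : ℕ) - d + 1, by have := m.isLt; omega⟩ 0)
        - wordMap g w (g ⟨(m : ℕ) - d, by have := m.isLt; omega⟩ 1)) / wordLen g w

/-- The open simplex `Simp_{2d-2} ⊆ (0,1)^{2d-1}` of vectors with coordinate sum `1`. -/
def Simp (d : ℕ) : Set (Fin (2*d-1) → ℝ) :=
  {s | (∀ m, s m ∈ Set.Ioo (0:ℝ) 1) ∧ ∑ m, s m = 1}

/-- The initial word `j|_n = (j_1,…,j_n)` of a sequence `j ∈ Σ_d^dual = {1,…,d}^ℕ`. -/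
def dword {d : ℕ} (j : ℕ → Fin d) (n : ℕ) : List (Fin d) :=
  List.ofFn (fun i : Fin n => j i)

/-- `S` is the scaling function of the system `g`:
`S(j) = lim_{n→∞} S_n(j|_n)` for every `j ∈ Σ_d^dual`. -/
def HasScalingFunction {d : ℕ} (g : Fin d → ℝ → ℝ) (S : (ℕ → Fin d) → Fin (2*d-1) → ℝ) : Prop :=
  ∀ j : ℕ → Fin d,
    Filter.Tendsto (fun n => scalingData g (dword j n)) Filter.atTop (nhds (S j))

/-- `ρ_S(j,j')` where `n = #(j∩j')`:
`ρ_S(j,j') = sup_w ∏_{t=1}^{n} S((j_{t+1},…,j_n)·w)_{j_t}` (depends only on `j` and `n`). -/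
def rhoS {d : ℕ} (S : (ℕ → Fin d) → Fin (2*d-1) → ℝ) (j : ℕ → Fin d) (n : ℕ) : ℝ :=
  ⨆ w : ℕ → Fin d, ∏ t ∈ Finset.range n,
    S (fun m => if t + 1 + m < n then j (t + 1 + m) else w (t + 1 + m - n))
      ⟨((j t) : ℕ), by have := (j t).isLt; omega⟩

/-- Given a scaling vector `s ∈ Simp_{2d-2}`, the partition of `[0,1]` it determines has
`i`-th child interval starting at `childLeft s i = ∑_{m<i} (s_m + s_{d+m})`. -/
def childLeft {d : ℕ} (s : Fin (2*d-1) → ℝ) (i : Fin d) : ℝ :=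
  ∑ m ∈ (Finset.range (i : ℕ)).attach,
    (s ⟨(m : ℕ), by have h := Finset.mem_range.mp m.2; have := i.isLt; omega⟩
      + s ⟨d + (m : ℕ), by have h := Finset.mem_range.mp m.2; have := i.isLt; omega⟩)

/-- The right endpoint of the `i`-th child interval of the partition determined by `s`. -/
def childRight {d : ℕ} (s : Fin (2*d-1) → ℝ) (i : Fin d) : ℝ :=
  childLeft s i + s ⟨(i : ℕ), by have := i.isLt; omega⟩

/-- `A(j)`: the set of `2d` endpoints of the `d` child intervals of the partition of `[0,1]`
determined by the scaling vector `s = S(j)`. -/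
def Apts {d : ℕ} (s : Fin (2*d-1) → ℝ) : Set ℝ :=
  ⋃ i : Fin d, {childLeft s i, childRight s i}

/-- An increasing `C^k` diffeomorphism of `[0,1]`. -/
structure IsDiffeo01 (k : ℕ) (φ : ℝ → ℝ) : Prop where
  smooth : ContDiffOn ℝ k φ I01
  mono : StrictMonoOn φ I01
  deriv_pos : ∀ x ∈ I01, 0 < derivWithin φ I01 x
  bij : Set.BijOn φ I01 I01

/-- `D^k(A₁,A₂)`: increasing `C^k` diffeomorphisms of `[0,1]` mapping `A₁` onto `A₂`. -/
def Dk (k : ℕ) (A₁ A₂ : Set ℝ) : Set (ℝ → ℝ) :=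
  {φ | IsDiffeo01 k φ ∧ φ '' A₁ = A₂}

/-- `D^k_var(M)(A₁,A₂)`: members of `D^k(A₁,A₂)` whose `k`-th derivative has variation `< M`. -/
def DkVar (k : ℕ) (M : ℝ) (A₁ A₂ : Set ℝ) : Set (ℝ → ℝ) :=
  {φ | φ ∈ Dk k A₁ A₂ ∧ ∀ x ∈ I01, ∀ y ∈ I01,
    |iteratedDerivWithin k φ I01 x - iteratedDerivWithin k φ I01 y| < M}

/-- The renormalization `(L')⁻¹ ∘ φ ∘ L` of `φ`, where `L, L'` are the increasing affine
bijections from `[0,1]` onto `[a,b]` and `[a',b']` respectively. -/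
def renorm (a b a' b' : ℝ) (φ : ℝ → ℝ) : ℝ → ℝ :=
  fun x => (φ (a + (b - a) * x) - a') / (b' - a')

/-- `R_{j₀} φ`: restrict `φ` to the `j₀`-th child interval of the partition determined by `s`
(mapped to the `j₀`-th child interval of the partition determined by `s'`) and renormalize. -/
def Rmap {d : ℕ} (s s' : Fin (2*d-1) → ℝ) (j₀ : Fin d) (φ : ℝ → ℝ) : ℝ → ℝ :=
  renorm (childLeft s j₀) (childRight s j₀) (childLeft s' j₀) (childRight s' j₀) φ

/-- `j₀·j = (j₀, j_1, j_2, …)`. -/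
def consSeq {d : ℕ} (j₀ : Fin d) (j : ℕ → Fin d) : ℕ → Fin d :=
  fun m => if m = 0 then j₀ else j (m - 1)

/-- The Cantor set of the system: `C = ⋂_{n ≥ 1} ⋃_{w of length n} I_w`. -/
def systemCantorSet {d : ℕ} (g : Fin d → ℝ → ℝ) : Set ℝ :=
  ⋂ n : ℕ, ⋃ w ∈ {w : List (Fin d) | w.length = n + 1}, wordMap g w '' I01

end

section HolderClasses

/-- `f` is of class `C^{n+α}` on `[0,1]`: it has `n` successive derivatives within `[0,1]`,
the last of which satisfies an `α`-Hölder bound. -/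
def HolderDiff (α : ℝ) : ℕ → (ℝ → ℝ) → Prop
  | 0, f => ∃ H, 0 ≤ H ∧ HolderBoundOn01 α H f
  | n + 1, f => ∃ f' : ℝ → ℝ, (∀ x ∈ I01, HasDerivWithinAt f (f' x) I01 x) ∧ HolderDiff α n f'

lemma abs_sub_le_of_hasDerivWithinAt {f f' : ℝ → ℝ} {K : ℝ}
    (hf : ∀ x ∈ I01, HasDerivWithinAt f (f' x) I01 x) (hK : ∀ x ∈ I01, |f' x| ≤ K) :
    ∀ x ∈ I01, ∀ y ∈ I01, |f x - f y| ≤ K * |x - y| := fun _ hx _ hy =>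
  Convex.norm_image_sub_le_of_norm_hasDerivWithin_le hf hK (convex_Icc 0 1) hy hx

lemma exists_bound_of_continuousOn {f : ℝ → ℝ} (hf : ContinuousOn f I01) :
    ∃ M, 0 ≤ M ∧ ∀ x ∈ I01, |f x| ≤ M := by
  obtain ⟨M, hM⟩ := isCompact_Icc.exists_bound_of_continuousOn hf
  exact ⟨M, (abs_nonneg _).trans (hM 0 (by simp)), hM⟩

lemma exists_pos_le_of_continuousOn {f : ℝ → ℝ} (hf : ContinuousOn f I01)
    (hpos : ∀ x ∈ I01, 0 < f x) : ∃ m, 0 < m ∧ ∀ x ∈ I01, m ≤ f x := by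
  obtain ⟨x, hx, h⟩ := isCompact_Icc.exists_isMinOn (Set.nonempty_Icc.2 zero_le_one) hf
  exact ⟨f x, hpos x hx, fun y hy => h hy⟩

lemma exists_lt_one_of_continuousOn {f : ℝ → ℝ} (hf : ContinuousOn f I01)
    (h1 : ∀ x ∈ I01, f x < 1) : ∃ m, m < 1 ∧ ∀ x ∈ I01, f x ≤ m := by
  obtain ⟨x, hx, h⟩ := isCompact_Icc.exists_isMaxOn (Set.nonempty_Icc.2 zero_le_one) hf
  exact ⟨f x, h1 x hx, fun y hy => h hy⟩

lemma abs_sub_le_one_of_mem {x y : ℝ} (hx : x ∈ I01) (hy : y ∈ I01) : |x - y| ≤ 1 := by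
  rw [abs_le]; constructor <;> linarith [hx.1, hx.2, hy.1, hy.2]

/-- An antiderivative on `[0,1]` of a function continuous there. -/
lemma exists_antideriv {w : ℝ → ℝ} (hw : ContinuousOn w I01) :
    ∃ V : ℝ → ℝ, ∀ x ∈ I01, HasDerivWithinAt V (w x) I01 x := by
  have hc : Continuous (IccExtend (zero_le_one' ℝ) (I01.domRestrict w)) :=
    (continuousOn_iff_continuous_domRestrict.1 hw).Icc_extend'
  refine ⟨fun x => ∫ t in (0:ℝ)..x, IccExtend (zero_le_one' ℝ) (I01.domRestrict w) t, fun x hx => ?_⟩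
  have h := (hc.integral_hasStrictDerivAt 0 x).hasDerivAt.hasDerivWithinAt (s := I01)
  rwa [IccExtend_of_mem _ _ hx] at h

lemma eq_of_hasDerivWithinAt_zero {f f' : ℝ → ℝ}
    (hf : ∀ x ∈ I01, HasDerivWithinAt f (f' x) I01 x) (h0 : ∀ x ∈ I01, f' x = 0) :
    ∀ x ∈ I01, ∀ y ∈ I01, f x = f y := by
  intro x hx y hy
  have h := abs_sub_le_of_hasDerivWithinAt hf (K := 0) (fun x hx => by simp [h0 x hx]) x hx y hy
  rw [zero_mul] at h
  exact sub_eq_zero.1 (abs_nonpos_iff.1 h)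

lemma exists_slope_eq_deriv {f f' : ℝ → ℝ} (hf : ∀ x ∈ I01, HasDerivWithinAt f (f' x) I01 x)
    {a b : ℝ} (ha : a ∈ I01) (hb : b ∈ I01) (hab : a < b) :
    ∃ c ∈ Ioo a b, f b - f a = f' c * (b - a) := by
  have hsub : Icc a b ⊆ I01 := Icc_subset_Icc ha.1 hb.2
  obtain ⟨c, hc, h⟩ := exists_hasDerivAt_eq_slope f f' hab
    (fun x hx => ((hf x (hsub hx)).continuousWithinAt).mono hsub)
    (fun x hx => (hf x (hsub (Ioo_subset_Icc_self hx))).hasDerivAt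
      (Icc_mem_nhds (ha.1.trans_lt hx.1) (hx.2.trans_le hb.2)))
  refine ⟨c, hc, ?_⟩
  rw [h, div_mul_cancel₀ _ (sub_pos.2 hab).ne']

lemma strictMonoOn_I01_of_deriv_pos {f f' : ℝ → ℝ}
    (hf : ∀ x ∈ I01, HasDerivWithinAt f (f' x) I01 x) (hpos : ∀ x ∈ I01, 0 < f' x) :
    StrictMonoOn f I01 := by
  intro a ha b hb hab
  obtain ⟨c, hc, h⟩ := exists_slope_eq_deriv hf ha hb hab
  have := mul_pos (hpos c ⟨ha.1.trans hc.1.le, hc.2.le.trans hb.2⟩) (sub_pos.2 hab)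
  linarith

variable {α : ℝ} {n : ℕ} {f g : ℝ → ℝ}

lemma HolderBoundOn01.continuousOn {H : ℝ} (hα : 0 < α) (hf : HolderBoundOn01 α H f) :
    ContinuousOn f I01 := by
  intro x hx
  rw [ContinuousWithinAt, tendsto_iff_dist_tendsto_zero]
  have hlim : Tendsto (fun y : ℝ => H * |y - x| ^ α) (nhdsWithin x I01) (nhds 0) := by
    have hc : Continuous fun y : ℝ => H * |y - x| ^ α :=
      continuous_const.mul ((continuous_id.sub continuous_const).abs.rpow_const
        fun _ => Or.inr hα.le)
    have h := (hc.tendsto x).mono_left (nhdsWithin_le_nhds (s := I01))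
    simpa [Real.zero_rpow hα.ne'] using h
  refine squeeze_zero' (Eventually.of_forall fun _ => dist_nonneg) ?_ hlim
  filter_upwards [self_mem_nhdsWithin] with y hy
  exact hf y hy x hx

lemma HolderDiff.continuousOn (hα : 0 < α) (hf : HolderDiff α n f) : ContinuousOn f I01 := by
  cases n with
  | zero => obtain ⟨H, _, h⟩ := hf; exact h.continuousOn hα
  | succ n => obtain ⟨f', h, _⟩ := hf; exact fun x hx => (h x hx).continuousWithinAt

lemma HolderDiff.congr (hf : HolderDiff α n f) (hfg : EqOn g f I01) : HolderDiff α n g := by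
  cases n with
  | zero =>
    obtain ⟨H, h0, h⟩ := hf
    exact ⟨H, h0, fun x hx y hy => by rw [hfg hx, hfg hy]; exact h x hx y hy⟩
  | succ n =>
    obtain ⟨f', h, h'⟩ := hf
    exact ⟨f', fun x hx => (h x hx).congr hfg (hfg hx), h'⟩

lemma holderDiff_zero_of_lipschitz (hα1 : α ≤ 1) {K : ℝ}
    (h : ∀ x ∈ I01, ∀ y ∈ I01, |f x - f y| ≤ K * |x - y|) : HolderDiff α 0 f := by
  refine ⟨|K|, abs_nonneg K, fun x hx y hy => (h x hx y hy).trans ?_⟩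
  rcases eq_or_ne x y with rfl | hne
  · rw [sub_self, abs_zero, mul_zero]
    exact mul_nonneg (abs_nonneg K) (Real.rpow_nonneg le_rfl _)
  have h1 : |x - y| ≤ |x - y| ^ α := by
    simpa using Real.rpow_le_rpow_of_exponent_ge (abs_pos.2 (sub_ne_zero.2 hne))
      (abs_sub_le_one_of_mem hx hy) hα1
  exact mul_le_mul (le_abs_self K) h1 (abs_nonneg _) (abs_nonneg _)

lemma HolderDiff.of_succ (hα : 0 < α) (hα1 : α ≤ 1) (hf : HolderDiff α (n + 1) f) :
    HolderDiff α n f := by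
  induction n generalizing f with
  | zero =>
    obtain ⟨f', h, h'⟩ := hf
    obtain ⟨M, -, hM⟩ := exists_bound_of_continuousOn (h'.continuousOn hα)
    exact holderDiff_zero_of_lipschitz hα1 (abs_sub_le_of_hasDerivWithinAt h hM)
  | succ n ih =>
    obtain ⟨f', h, h'⟩ := hf
    exact ⟨f', h, ih h'⟩

lemma holderDiff_const (c : ℝ) : HolderDiff α n fun _ => c := by
  induction n generalizing c with
  | zero => exact ⟨0, le_rfl, fun x _ y _ => by simp⟩
  | succ n ih => exact ⟨fun _ => 0, fun x _ => hasDerivWithinAt_const x I01 c, ih 0⟩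

lemma holderDiff_id (hα1 : α ≤ 1) : HolderDiff α n fun x => x := by
  cases n with
  | zero => exact holderDiff_zero_of_lipschitz hα1 (K := 1) fun x _ y _ => by rw [one_mul]
  | succ n => exact ⟨fun _ => 1, fun x _ => hasDerivWithinAt_id x I01, holderDiff_const 1⟩

lemma HolderDiff.add (hf : HolderDiff α n f) (hg : HolderDiff α n g) :
    HolderDiff α n fun x => f x + g x := by
  induction n generalizing f g with
  | zero =>
    obtain ⟨H, h0, h⟩ := hf
    obtain ⟨K, k0, k⟩ := hg
    refine ⟨H + K, add_nonneg h0 k0, fun x hx y hy => ?_⟩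
    have := abs_add_le (f x - f y) (g x - g y)
    rw [add_mul, add_sub_add_comm]
    linarith [h x hx y hy, k x hx y hy]
  | succ n ih =>
    obtain ⟨f', h, h'⟩ := hf
    obtain ⟨g', k, k'⟩ := hg
    exact ⟨fun x => f' x + g' x, fun x hx => (h x hx).add (k x hx), ih h' k'⟩

lemma HolderDiff.mul (hα : 0 < α) (hα1 : α ≤ 1) (hf : HolderDiff α n f)
    (hg : HolderDiff α n g) : HolderDiff α n fun x => f x * g x := by
  induction n generalizing f g with
  | zero =>
    obtain ⟨M, M0, hM⟩ := exists_bound_of_continuousOn (hf.continuousOn hα)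
    obtain ⟨N, N0, hN⟩ := exists_bound_of_continuousOn (hg.continuousOn hα)
    obtain ⟨H, h0, h⟩ := hf
    obtain ⟨K, k0, k⟩ := hg
    refine ⟨M * K + H * N, by positivity, fun x hx y hy => ?_⟩
    have h1 : f x * g x - f y * g y = f x * (g x - g y) + (f x - f y) * g y := by ring
    rw [h1]
    refine (abs_add_le _ _).trans ?_
    rw [abs_mul, abs_mul, add_mul, mul_assoc]
    have h2 := mul_le_mul (hM x hx) (k x hx y hy) (abs_nonneg _) M0
    have h3 := mul_le_mul (h x hx y hy) (hN y hy) (abs_nonneg _)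
      (mul_nonneg h0 (Real.rpow_nonneg (abs_nonneg _) _))
    linarith
  | succ n ih =>
    have hf1 := hf.of_succ hα hα1
    have hg1 := hg.of_succ hα hα1
    obtain ⟨f', h, h'⟩ := hf
    obtain ⟨g', k, k'⟩ := hg
    exact ⟨fun x => f' x * g x + f x * g' x, fun x hx => (h x hx).mul (k x hx),
      (ih h' hg1).add (ih hf1 k')⟩

lemma HolderDiff.const_mul (hα : 0 < α) (hα1 : α ≤ 1) (c : ℝ) (hf : HolderDiff α n f) :
    HolderDiff α n fun x => c * f x :=
  (holderDiff_const c).mul hα hα1 hf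

/-- Composition with a Lipschitz inner function. -/
lemma HolderDiff.comp (hα : 0 < α) (hα1 : α ≤ 1) (hf : HolderDiff α n f)
    (hg : HolderDiff α n g) (hmaps : MapsTo g I01 I01) {K : ℝ}
    (hK : ∀ x ∈ I01, ∀ y ∈ I01, |g x - g y| ≤ K * |x - y|) :
    HolderDiff α n fun x => f (g x) := by
  induction n generalizing f with
  | zero =>
    obtain ⟨H, h0, h⟩ := hf
    refine ⟨H * |K| ^ α, mul_nonneg h0 (Real.rpow_nonneg (abs_nonneg _) _),
      fun x hx y hy => (h _ (hmaps hx) _ (hmaps hy)).trans ?_⟩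
    rw [mul_assoc, ← Real.mul_rpow (abs_nonneg _) (abs_nonneg _)]
    refine mul_le_mul_of_nonneg_left (Real.rpow_le_rpow (abs_nonneg _) ?_ hα.le) h0
    exact (hK x hx y hy).trans (mul_le_mul_of_nonneg_right (le_abs_self K) (abs_nonneg _))
  | succ n ih =>
    have hg1 := hg.of_succ hα hα1
    obtain ⟨f', h, h'⟩ := hf
    obtain ⟨g', k, k'⟩ := hg
    exact ⟨fun x => f' (g x) * g' x, fun x hx => (h _ (hmaps hx)).comp x (k x hx) hmaps,
      (ih h' hg1).mul hα hα1 k'⟩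

lemma HolderDiff.exp (hα : 0 < α) (hα1 : α ≤ 1) (hf : HolderDiff α n f) :
    HolderDiff α n fun x => Real.exp (f x) := by
  induction n with
  | zero =>
    obtain ⟨M, M0, hM⟩ := exists_bound_of_continuousOn (hf.continuousOn hα)
    obtain ⟨H, h0, h⟩ := hf
    refine ⟨Real.exp M * H, by positivity, fun x hx y hy => ?_⟩
    have h1 : ‖Real.exp (f x) - Real.exp (f y)‖ ≤ Real.exp M * ‖f x - f y‖ := by
      refine Convex.norm_image_sub_le_of_norm_hasDerivWithin_le (s := Icc (-M) M)
        (f' := Real.exp) (fun z _ => (Real.hasDerivAt_exp z).hasDerivWithinAt) (fun z hz => ?_)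
        (convex_Icc _ _) (abs_le.1 (hM y hy)) (abs_le.1 (hM x hx))
      rw [Real.norm_eq_abs, abs_of_pos (Real.exp_pos z)]
      exact Real.exp_le_exp.2 hz.2
    rw [mul_assoc]
    exact h1.trans (mul_le_mul_of_nonneg_left (h x hx y hy) (Real.exp_pos _).le)
  | succ n ih =>
    have hf1 := hf.of_succ hα hα1
    obtain ⟨f', h, h'⟩ := hf
    exact ⟨fun x => Real.exp (f x) * f' x, fun x hx => (h x hx).exp, (ih hf1).mul hα hα1 h'⟩

lemma HolderDiff.inv (hα : 0 < α) (hα1 : α ≤ 1) (hf : HolderDiff α n f)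
    (hpos : ∀ x ∈ I01, 0 < f x) : HolderDiff α n fun x => (f x)⁻¹ := by
  induction n with
  | zero =>
    obtain ⟨m, m0, hm⟩ := exists_pos_le_of_continuousOn (hf.continuousOn hα) hpos
    obtain ⟨H, h0, h⟩ := hf
    refine ⟨H / (m * m), by positivity, fun x hx y hy => ?_⟩
    have hx0 := hpos x hx
    have hy0 := hpos y hy
    rw [inv_sub_inv hx0.ne' hy0.ne', abs_div, abs_sub_comm, abs_of_pos (mul_pos hx0 hy0),
      div_mul_eq_mul_div]
    exact div_le_div₀ (mul_nonneg h0 (Real.rpow_nonneg (abs_nonneg _) _)) (h x hx y hy)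
      (mul_pos m0 m0) (mul_le_mul (hm x hx) (hm y hy) m0.le hx0.le)
  | succ n ih =>
    have hi := ih (hf.of_succ hα hα1)
    obtain ⟨f', h, h'⟩ := hf
    refine ⟨fun x => -1 * f' x * ((f x)⁻¹ * (f x)⁻¹), fun x hx => ?_,
      (h'.const_mul hα hα1 (-1)).mul hα hα1 (hi.mul hα hα1 hi)⟩
    have hx0 := (hpos x hx).ne'
    exact ((h x hx).fun_inv hx0).congr_deriv (by field_simp)

lemma HolderDiff.log (hα : 0 < α) (hα1 : α ≤ 1) (hf : HolderDiff α n f)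
    (hpos : ∀ x ∈ I01, 0 < f x) : HolderDiff α n fun x => Real.log (f x) := by
  cases n with
  | zero =>
    obtain ⟨m, m0, hm⟩ := exists_pos_le_of_continuousOn (hf.continuousOn hα) hpos
    obtain ⟨H, h0, h⟩ := hf
    refine ⟨m⁻¹ * H, by positivity, fun x hx y hy => ?_⟩
    have h1 : ‖Real.log (f x) - Real.log (f y)‖ ≤ m⁻¹ * ‖f x - f y‖ := by
      refine Convex.norm_image_sub_le_of_norm_hasDerivWithin_le (s := Ici m)
        (f' := fun z => z⁻¹)
        (fun z hz => (Real.hasDerivAt_log (m0.trans_le hz).ne').hasDerivWithinAt) (fun z hz => ?_)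
        (convex_Ici _) (hm y hy) (hm x hx)
      rw [Real.norm_eq_abs, abs_of_pos (inv_pos.2 (m0.trans_le hz))]
      exact inv_anti₀ m0 hz
    rw [mul_assoc]
    exact h1.trans (mul_le_mul_of_nonneg_left (h x hx y hy) (inv_pos.2 m0).le)
  | succ n =>
    have hi := (hf.of_succ hα hα1).inv hα hα1 hpos
    obtain ⟨f', h, h'⟩ := hf
    exact ⟨fun x => f' x * (f x)⁻¹, fun x hx => (h x hx).log (hpos x hx).ne',
      h'.mul hα hα1 hi⟩

lemma holderDiff_rpow {ε : ℝ} (hε : 0 < ε) (hε1 : ε ≤ 1) (n : ℕ) :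
    HolderDiff ε n fun x => x ^ ((n : ℝ) + ε) := by
  induction n with
  | zero =>
    refine ⟨1, zero_le_one, ?_⟩
    have key : ∀ x ∈ I01, ∀ y ∈ I01, y ≤ x → |x ^ ε - y ^ ε| ≤ |x - y| ^ ε := by
      intro x hx y hy hyx
      rw [abs_of_nonneg (sub_nonneg.2 (Real.rpow_le_rpow hy.1 hyx hε.le)),
        abs_of_nonneg (sub_nonneg.2 hyx), sub_le_iff_le_add]
      simpa using Real.rpow_add_le_add_rpow (sub_nonneg.2 hyx) hy.1 hε.le hε1
    intro x hx y hy
    simp only [Nat.cast_zero, zero_add, one_mul]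
    rcases le_total y x with h | h
    · exact key x hx y hy h
    · rw [abs_sub_comm, abs_sub_comm x y]; exact key y hy x hx h
  | succ n ih =>
    refine ⟨fun x => ((n : ℝ) + 1 + ε) * x ^ ((n : ℝ) + ε), fun x _ => ?_,
      ih.const_mul hε hε1 _⟩
    have h1 : (1 : ℝ) ≤ ((n + 1 : ℕ) : ℝ) + ε := by push_cast; linarith [n.cast_nonneg (α := ℝ)]
    have h := (Real.hasDerivAt_rpow_const (x := x) (Or.inr h1)).hasDerivWithinAt (s := I01)
    refine h.congr_deriv ?_
    rw [show ((n + 1 : ℕ) : ℝ) + ε - 1 = n + ε by push_cast; ring]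
    push_cast
    ring

lemma holderDiff_iff (hα : 0 < α) :
    HolderDiff α n f ↔ ContDiffOn ℝ n f I01 ∧
      ∃ H > 0, HolderBoundOn01 α H (iteratedDerivWithin n f I01) := by
  have hu : UniqueDiffOn ℝ I01 := uniqueDiffOn_Icc one_pos
  induction n generalizing f with
  | zero =>
    rw [iteratedDerivWithin_zero]
    constructor
    · intro hf
      obtain ⟨H, h0, h⟩ := id hf
      refine ⟨by simpa using hf.continuousOn hα, H + 1, by positivity, fun x hx y hy => ?_⟩
      have := Real.rpow_nonneg (abs_nonneg (x - y)) α
      linarith [h x hx y hy]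
    · rintro ⟨-, H, h0, h⟩
      exact ⟨H, h0.le, h⟩
  | succ n ih =>
    rw [iteratedDerivWithin_succ', Nat.cast_succ, contDiffOn_succ_iff_derivWithin hu]
    constructor
    · rintro ⟨f', h, h'⟩
      have he : EqOn (derivWithin f I01) f' I01 := fun x hx =>
        (h x hx).derivWithin (hu x hx)
      obtain ⟨h1, h2⟩ := ih.1 (h'.congr he)
      exact ⟨⟨fun x hx => (h x hx).differentiableWithinAt,
        fun h => absurd h (WithTop.coe_ne_top (α := ℕ∞) (a := n)), h1⟩, h2⟩
    · rintro ⟨⟨h1, -, h2⟩, h3⟩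
      exact ⟨derivWithin f I01, fun x hx => (h1 x hx).hasDerivWithinAt, ih.2 ⟨h2, h3⟩⟩

end HolderClasses

section FunctionalEquations

variable {α : ℝ} {n : ℕ} {G G₁ : ℝ → ℝ}

lemma abs_iterate_sub_one_le (hG : ∀ x ∈ I01, HasDerivWithinAt G (G₁ x) I01 x)
    (hmaps : MapsTo G I01 I01) (hfix : G 1 = 1) {l : ℝ} (hl0 : 0 ≤ l)
    (hl : ∀ x ∈ I01, |G₁ x| ≤ l) (m : ℕ) : ∀ x ∈ I01, |G^[m] x - 1| ≤ l ^ m := by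
  have h1 : (1 : ℝ) ∈ I01 := right_mem_Icc.2 zero_le_one
  induction m with
  | zero => intro x hx; simpa using abs_sub_le_one_of_mem hx h1
  | succ m ih =>
    intro x hx
    rw [Function.iterate_succ_apply', pow_succ']
    have h := abs_sub_le_of_hasDerivWithinAt hG hl _ (hmaps.iterate m hx) 1 h1
    rw [hfix] at h
    exact h.trans (mul_le_mul_of_nonneg_left (ih x hx) hl0)

lemma abs_iterate_sub_le (hG : ∀ x ∈ I01, HasDerivWithinAt G (G₁ x) I01 x)
    (hmaps : MapsTo G I01 I01) {l : ℝ} (hl0 : 0 ≤ l)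
    (hl : ∀ x ∈ I01, |G₁ x| ≤ l) (m : ℕ) :
    ∀ x ∈ I01, ∀ y ∈ I01, |G^[m] x - G^[m] y| ≤ l ^ m * |x - y| := by
  induction m with
  | zero => intro x _ y _; simp
  | succ m ih =>
    intro x hx y hy
    rw [Function.iterate_succ_apply', Function.iterate_succ_apply', pow_succ', mul_assoc]
    exact (abs_sub_le_of_hasDerivWithinAt hG hl _ (hmaps.iterate m hx) _ (hmaps.iterate m hy)).trans
      (mul_le_mul_of_nonneg_left (ih x hx y hy) hl0)

lemma le_self_of_fix_one (hG : ∀ x ∈ I01, HasDerivWithinAt G (G₁ x) I01 x) (hfix : G 1 = 1)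
    (hG₁ : ∀ x ∈ I01, |G₁ x| ≤ 1) {x : ℝ} (hx : x ∈ I01) : x ≤ G x := by
  have h := abs_sub_le_of_hasDerivWithinAt hG hG₁ 1 (right_mem_Icc.2 zero_le_one) x hx
  rw [hfix, one_mul, abs_of_nonneg (sub_nonneg.2 hx.2)] at h
  linarith [le_abs_self (1 - G x)]

/-- A bounded solution of a contracting cohomological equation with Hölder data is Hölder. -/
lemma holderDiff_zero_of_solution {a b v : ℝ → ℝ} {M μ : ℝ} (hα : 0 < α)
    (hmaps : MapsTo G I01 I01) (hG : ∀ x ∈ I01, ∀ y ∈ I01, |G x - G y| ≤ |x - y|)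
    (hμ0 : 0 ≤ μ) (hμ : μ < 1) (ha : HolderDiff α 0 a) (hb : HolderDiff α 0 b)
    (hbμ : ∀ x ∈ I01, |b x| ≤ μ) (hM : ∀ x ∈ I01, |v x| ≤ M)
    (hv : ∀ x ∈ I01, v x = a x + b x * v (G x)) : HolderDiff α 0 v := by
  obtain ⟨A, A0, hA⟩ := ha
  obtain ⟨B, B0, hB⟩ := hb
  have M0 : 0 ≤ M := (abs_nonneg _).trans (hM 0 (left_mem_Icc.2 zero_le_one))
  have hμ' : 0 < 1 - μ := sub_pos.2 hμ
  set C := (A + B * M) / (1 - μ) with hC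
  have C0 : 0 ≤ C := by positivity
  have hCeq : A + B * M + μ * C = C := by rw [hC]; field_simp; ring
  have key : ∀ m : ℕ, ∀ x ∈ I01, ∀ y ∈ I01,
      |v x - v y| ≤ C * |x - y| ^ α + μ ^ m * (2 * M) := by
    intro m
    induction m with
    | zero =>
      intro x hx y hy
      have h1 := abs_sub (v x) (v y)
      have h2 := mul_nonneg C0 (Real.rpow_nonneg (abs_nonneg (x - y)) α)
      linarith [hM x hx, hM y hy]
    | succ m ih =>
      intro x hx y hy
      have e : v x - v y
          = (a x - a y) + b x * (v (G x) - v (G y)) + (b x - b y) * v (G y) := by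
        rw [hv x hx, hv y hy]; ring
      have h1 : |v x - v y|
          ≤ |a x - a y| + |b x| * |v (G x) - v (G y)| + |b x - b y| * |v (G y)| := by
        rw [e, ← abs_mul, ← abs_mul]
        exact abs_add_three _ _ _
      have hd := Real.rpow_le_rpow (abs_nonneg _) (hG x hx y hy) hα.le
      have h2 : |b x| * |v (G x) - v (G y)|
          ≤ μ * (C * |x - y| ^ α + μ ^ m * (2 * M)) := by
        refine mul_le_mul (hbμ x hx) ((ih _ (hmaps hx) _ (hmaps hy)).trans ?_) (abs_nonneg _) hμ0
        exact add_le_add (mul_le_mul_of_nonneg_left hd C0) le_rfl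
      have h3 : |b x - b y| * |v (G y)| ≤ B * |x - y| ^ α * M :=
        mul_le_mul (hB x hx y hy) (hM _ (hmaps hy)) (abs_nonneg _) ((abs_nonneg _).trans (hB x hx y hy))
      have h4 : C * |x - y| ^ α + μ ^ (m + 1) * (2 * M) = A * |x - y| ^ α
          + μ * (C * |x - y| ^ α + μ ^ m * (2 * M)) + B * |x - y| ^ α * M := by
        nth_rewrite 1 [← hCeq]
        ring
      rw [h4]
      linarith [hA x hx y hy]
  refine ⟨C, C0, fun x hx y hy => ?_⟩
  have hlim : Tendsto (fun m : ℕ => C * |x - y| ^ α + μ ^ m * (2 * M)) atTop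
      (nhds (C * |x - y| ^ α + 0 * (2 * M))) :=
    ((tendsto_pow_atTop_nhds_zero_of_lt_one hμ0 hμ).mul_const _).const_add _
  rw [zero_mul, add_zero] at hlim
  exact ge_of_tendsto' hlim fun m => key m x hx y hy

lemma eq_zero_of_deriv_eq_neg_mul_comp {D b b' : ℝ → ℝ} {μ C : ℝ}
    (hG : ∀ x ∈ I01, HasDerivWithinAt G (G₁ x) I01 x)
    (hmaps : MapsTo G I01 I01) (hfix : G 1 = 1) (hG₁ : ∀ x ∈ I01, |G₁ x| ≤ 1)
    (hD : ContinuousOn D I01) (hD1 : D 1 = 0) (hμ0 : 0 ≤ μ) (hμ : μ < 1)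
    (hb : ∀ x ∈ I01, |b x| ≤ μ) (hb' : ∀ x ∈ I01, |b' x| ≤ C)
    (hderiv : ∀ x ∈ I01,
      HasDerivWithinAt (fun x => D x - b x * D (G x)) (-(b' x * D (G x))) I01 x) :
    ∀ x ∈ I01, D x = 0 := by
  have h1 : (1 : ℝ) ∈ I01 := right_mem_Icc.2 zero_le_one
  have C0 : 0 ≤ C := (abs_nonneg _).trans (hb' 1 h1)
  have hμ' : 0 < 1 - μ := sub_pos.2 hμ
  set K := 2 * C / (1 - μ) + 1 with hK
  have K0 : 0 < K := by positivity
  have hCK : C / K ≤ (1 - μ) / 2 := by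
    rw [div_le_iff₀ K0, hK]
    have : (1 - μ) / 2 * (2 * C / (1 - μ) + 1) = C + (1 - μ) / 2 := by field_simp
    rw [this]; linarith
  obtain ⟨x₀, hx₀, hmax⟩ := isCompact_Icc.exists_isMaxOn (s := I01)
    (f := fun x => |D x| * Real.exp (-(K * (1 - x)))) ⟨1, h1⟩
    (hD.abs.mul (by fun_prop))
  set N := |D x₀| * Real.exp (-(K * (1 - x₀))) with hN
  have N0 : 0 ≤ N := by positivity
  have hDN : ∀ x ∈ I01, |D x| ≤ N * Real.exp (K * (1 - x)) := by
    intro x hx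
    have h : |D x| * Real.exp (-(K * (1 - x))) ≤ N := hmax hx
    rwa [Real.exp_neg, ← div_eq_mul_inv, div_le_iff₀ (Real.exp_pos _)] at h
  have hDG : ∀ x ∈ I01, |D (G x)| ≤ N * Real.exp (K * (1 - x)) := by
    intro x hx
    refine (hDN _ (hmaps hx)).trans (mul_le_mul_of_nonneg_left (Real.exp_le_exp.2 ?_) N0)
    have := le_self_of_fix_one hG hfix hG₁ hx
    gcongr
  have hE : ∀ s : ℝ, |s| = 1 → ∀ x ∈ I01,
      0 ≤ s * (D x - b x * D (G x)) + C * N / K * Real.exp (K * (1 - x)) := by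
    intro s hs x hx
    rcases eq_or_lt_of_le hx.2 with rfl | hlt
    · rw [hfix, hD1]
      simp only [mul_zero, sub_zero, zero_add]
      positivity
    have hder : ∀ t ∈ I01, HasDerivWithinAt
        (fun x => s * (D x - b x * D (G x)) + C * N / K * Real.exp (K * (1 - x)))
        (s * (-(b' t * D (G t))) - C * (N * Real.exp (K * (1 - t)))) I01 t := by
      intro t ht
      have he : HasDerivAt (fun x : ℝ => Real.exp (K * (1 - x)))
          (Real.exp (K * (1 - t)) * (K * (-1))) t :=
        (((hasDerivAt_id t).const_sub 1).const_mul K).exp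
      refine (((hderiv t ht).const_mul s).add (he.hasDerivWithinAt.const_mul _)).congr_deriv ?_
      field_simp
      ring
    obtain ⟨c, hc, hslope⟩ := exists_slope_eq_deriv hder hx h1 hlt
    have hcI : c ∈ I01 := ⟨hx.1.trans hc.1.le, hc.2.le⟩
    have hneg : s * (-(b' c * D (G c))) - C * (N * Real.exp (K * (1 - c))) ≤ 0 := by
      refine sub_nonpos.2 ((le_abs_self _).trans ?_)
      rw [abs_mul, hs, one_mul, abs_neg, abs_mul]
      exact mul_le_mul (hb' c hcI) (hDG c hcI) (abs_nonneg _) C0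
    have h2 := mul_nonpos_of_nonpos_of_nonneg hneg (sub_pos.2 hlt).le
    rw [← hslope, hfix, hD1] at h2
    have h3 : 0 ≤ C * N / K * Real.exp (K * (1 - 1)) := by positivity
    linarith
  have hself : |D x₀| = N * Real.exp (K * (1 - x₀)) := by
    rw [hN, mul_assoc, ← Real.exp_add, neg_add_cancel, Real.exp_zero, mul_one]
  have hEx : |D x₀ - b x₀ * D (G x₀)| ≤ C / K * |D x₀| := by
    have e : C / K * |D x₀| = C * N / K * Real.exp (K * (1 - x₀)) := by rw [hself]; ring
    rw [e, abs_le]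
    have p1 := hE 1 abs_one x₀ hx₀
    have p2 := hE (-1) (by simp) x₀ hx₀
    constructor <;> linarith
  have hbD : |b x₀ * D (G x₀)| ≤ μ * |D x₀| := by
    rw [abs_mul, hself]
    exact mul_le_mul (hb _ hx₀) (hDG _ hx₀) (abs_nonneg _) hμ0
  have htri : |D x₀| ≤ |D x₀ - b x₀ * D (G x₀)| + |b x₀ * D (G x₀)| := by
    simpa using abs_add_le (D x₀ - b x₀ * D (G x₀)) (b x₀ * D (G x₀))
  have hz : |D x₀| = 0 := by
    have h2 := mul_le_mul_of_nonneg_right hCK (abs_nonneg (D x₀))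
    have h3 : 0 ≤ (1 - μ) * |D x₀| := by positivity
    nlinarith [abs_nonneg (D x₀)]
  intro x hx
  have hNz : N = 0 := by rw [hN, hz, zero_mul]
  have := hDN x hx
  rw [hNz, zero_mul] at this
  exact abs_nonpos_iff.1 this

/-- Contracting cohomological equations `v = a + b · (v ∘ G)` have solutions as regular as the
data. -/
lemma exists_holderDiff_solution (hα : 0 < α) (hα1 : α ≤ 1)
    (hG : ∀ x ∈ I01, HasDerivWithinAt G (G₁ x) I01 x)
    (hmaps : MapsTo G I01 I01) (hfix : G 1 = 1) (hG₁ : ∀ x ∈ I01, |G₁ x| ≤ 1) {μ : ℝ}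
    (hμ0 : 0 ≤ μ) (hμ : μ < 1) {a b : ℝ → ℝ} (hGn : HolderDiff α n G₁)
    (ha : HolderDiff α n a) (hb : HolderDiff α n b) (hbμ : ∀ x ∈ I01, |b x| ≤ μ) :
    ∃ v, HolderDiff α n v ∧ ∀ x ∈ I01, v x = a x + b x * v (G x) := by
  have h1 : (1 : ℝ) ∈ I01 := right_mem_Icc.2 zero_le_one
  have hLip : ∀ x ∈ I01, ∀ y ∈ I01, |G x - G y| ≤ 1 * |x - y| :=
    abs_sub_le_of_hasDerivWithinAt hG hG₁
  induction n generalizing a b with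
  | zero =>
    obtain ⟨M, M0, hM⟩ := exists_bound_of_continuousOn (ha.continuousOn hα)
    have hterm : ∀ x ∈ I01, ∀ m : ℕ,
        ‖(∏ i ∈ Finset.range m, b (G^[i] x)) * a (G^[m] x)‖ ≤ M * μ ^ m := by
      intro x hx m
      rw [norm_mul, norm_prod, mul_comm]
      refine mul_le_mul (hM _ (hmaps.iterate m hx)) ?_ (by positivity) M0
      calc ∏ i ∈ Finset.range m, ‖b (G^[i] x)‖ ≤ ∏ _i ∈ Finset.range m, μ :=
            Finset.prod_le_prod (fun _ _ => norm_nonneg _)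
              fun i _ => hbμ _ (hmaps.iterate i hx)
        _ = μ ^ m := by simp
    have hgeo : HasSum (fun m : ℕ => M * μ ^ m) (M * (1 - μ)⁻¹) :=
      (hasSum_geometric_of_lt_one hμ0 hμ).mul_left M
    have heq : ∀ x ∈ I01,
        ∑' m : ℕ, (∏ i ∈ Finset.range m, b (G^[i] x)) * a (G^[m] x)
          = a x + b x *
            ∑' m : ℕ, (∏ i ∈ Finset.range m, b (G^[i] (G x))) * a (G^[m] (G x)) := by
      intro x hx
      rw [(Summable.of_norm_bounded hgeo.summable (hterm x hx)).tsum_eq_zero_add,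
        ← tsum_mul_left]
      congr 1
      · simp
      · refine tsum_congr fun m => ?_
        rw [Finset.prod_range_succ']
        simp only [Function.iterate_succ_apply, Function.iterate_zero_apply]
        ring
    exact ⟨_, holderDiff_zero_of_solution hα hmaps (by simpa using hLip) hμ0 hμ ha hb hbμ
      (fun x hx => tsum_of_norm_bounded hgeo (hterm x hx)) heq, heq⟩
  | succ n ih =>
    have hGn' := hGn.of_succ hα hα1
    have hb0 := hb.of_succ hα hα1
    obtain ⟨v, hv, hveq⟩ := ih hGn' (ha.of_succ hα hα1) hb0 hbμ
    have hGd : HolderDiff α n G := HolderDiff.of_succ hα hα1 ⟨G₁, hG, hGn'⟩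
    obtain ⟨a', ha1, ha'⟩ := ha
    obtain ⟨b', hb1, hb'⟩ := hb
    have hbG : ∀ x ∈ I01, |b x * G₁ x| ≤ μ := by
      intro x hx
      rw [abs_mul]
      simpa using mul_le_mul (hbμ x hx) (hG₁ x hx) (abs_nonneg _) hμ0
    obtain ⟨w, hw, hweq⟩ := ih (a := fun x => a' x + b' x * v (G x))
      (b := fun x => b x * G₁ x) hGn'
      (ha'.add (hb'.mul hα hα1 (hv.comp hα hα1 hGd hmaps hLip))) (hb0.mul hα hα1 hGn') hbG
    obtain ⟨V, hV⟩ := exists_antideriv (hw.continuousOn hα)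
    obtain ⟨C, -, hC⟩ := exists_bound_of_continuousOn (hb'.continuousOn hα)
    have hz := eq_zero_of_deriv_eq_neg_mul_comp (D := fun x => v x - (V x + (v 1 - V 1)))
      hG hmaps hfix hG₁
      ((hv.continuousOn hα).sub (fun x hx => ((hV x hx).add_const _).continuousWithinAt))
      (by simp) hμ0 hμ hbμ hC (fun x hx => by
        have hVG : HasDerivWithinAt (fun x => V (G x)) (w (G x) * G₁ x) I01 x :=
          (hV _ (hmaps hx)).comp x (hG x hx) hmaps
        have hder := ((ha1 x hx).add ((hb1 x hx).mul (hVG.add_const (v 1 - V 1)))).sub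
          ((hV x hx).add_const (v 1 - V 1))
        refine (hder.congr (fun y hy => ?_) ?_).congr_deriv ?_
        · simp only [Pi.add_apply, Pi.sub_apply, Pi.mul_apply]
          rw [hveq y hy]; ring
        · simp only [Pi.add_apply, Pi.sub_apply, Pi.mul_apply]
          rw [hveq x hx]; ring
        · rw [hweq x hx]; ring)
    refine ⟨v, ⟨w, fun x hx => ?_, hw⟩, hveq⟩
    exact ((hV x hx).add_const (v 1 - V 1)).congr (fun y hy => sub_eq_zero.1 (hz y hy))
      (sub_eq_zero.1 (hz x hx))

/-- Solution of `Φ = u - u(1) + Φ ∘ G` for a contraction `G` fixing `1`. -/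
lemma exists_holderDiff_coboundary (hα : 0 < α) (hα1 : α ≤ 1)
    (hG : ∀ x ∈ I01, HasDerivWithinAt G (G₁ x) I01 x)
    (hmaps : MapsTo G I01 I01) (hfix : G 1 = 1) {l : ℝ} (hl0 : 0 ≤ l) (hl1 : l < 1)
    (hl : ∀ x ∈ I01, |G₁ x| ≤ l) {u : ℝ → ℝ} (hGn : HolderDiff α n G₁)
    (hu : HolderDiff α n u) :
    ∃ Φ, HolderDiff α n Φ ∧ ∀ x ∈ I01, Φ x = u x - u 1 + Φ (G x) := by
  have h1 : (1 : ℝ) ∈ I01 := right_mem_Icc.2 zero_le_one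
  cases n with
  | zero =>
    obtain ⟨H, H0, hH⟩ := hu
    have hla0 : 0 ≤ l ^ α := Real.rpow_nonneg hl0 _
    have hla1 : l ^ α < 1 := Real.rpow_lt_one hl0 hl1 hα
    have hgeo : ∀ c : ℝ, HasSum (fun m : ℕ => c * (l ^ α) ^ m) (c * (1 - l ^ α)⁻¹) := fun c =>
      (hasSum_geometric_of_lt_one hla0 hla1).mul_left c
    have hpow : ∀ m : ℕ, (l ^ m) ^ α = (l ^ α) ^ m := fun m => by
      rw [← Real.rpow_natCast, ← Real.rpow_natCast, ← Real.rpow_mul hl0, ← Real.rpow_mul hl0,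
        mul_comm]
    have hterm : ∀ x ∈ I01, ∀ m : ℕ, ‖u (G^[m] x) - u 1‖ ≤ H * (l ^ α) ^ m := by
      intro x hx m
      refine (hH _ (hmaps.iterate m hx) 1 h1).trans (mul_le_mul_of_nonneg_left ?_ H0)
      rw [← hpow]
      exact Real.rpow_le_rpow (abs_nonneg _)
        (abs_iterate_sub_one_le hG hmaps hfix hl0 hl m x hx) hα.le
    have hsum : ∀ x ∈ I01, Summable fun m : ℕ => u (G^[m] x) - u 1 := fun x hx =>
      Summable.of_norm_bounded (hgeo H).summable (hterm x hx)
    refine ⟨fun x => ∑' m : ℕ, (u (G^[m] x) - u 1),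
      ⟨H * (1 - l ^ α)⁻¹, by have := sub_pos.2 hla1; positivity, fun x hx y hy => ?_⟩,
      fun x hx => ?_⟩
    · rw [← (hsum x hx).tsum_sub (hsum y hy), mul_right_comm, ← Real.norm_eq_abs]
      refine tsum_of_norm_bounded (hgeo _) fun m => ?_
      rw [sub_sub_sub_cancel_right, mul_assoc]
      refine (hH _ (hmaps.iterate m hx) _ (hmaps.iterate m hy)).trans
        (mul_le_mul_of_nonneg_left ?_ H0)
      rw [← hpow, mul_comm, ← Real.mul_rpow (pow_nonneg hl0 m) (abs_nonneg _)]
      exact Real.rpow_le_rpow (abs_nonneg _) (abs_iterate_sub_le hG hmaps hl0 hl m x hx y hy) hα.le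
    · exact (hsum x hx).tsum_eq_zero_add
  | succ n =>
    have hGn' := hGn.of_succ hα hα1
    obtain ⟨u', hu1, hu'⟩ := hu
    obtain ⟨w, hw, hweq⟩ := exists_holderDiff_solution hα hα1 hG hmaps hfix
      (fun x hx => (hl x hx).trans hl1.le) hl0 hl1 hGn' hu' hGn' hl
    obtain ⟨Φ, hΦ⟩ := exists_antideriv (hw.continuousOn hα)
    refine ⟨Φ, ⟨w, hΦ, hw⟩, fun x hx => ?_⟩
    have hder : ∀ x ∈ I01, HasDerivWithinAt (fun x => Φ x - Φ (G x) - u x)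
        (w x - w (G x) * G₁ x - u' x) I01 x := fun x hx =>
      ((hΦ x hx).sub ((hΦ _ (hmaps hx)).comp x (hG x hx) hmaps)).sub (hu1 x hx)
    have h := eq_of_hasDerivWithinAt_zero hder (fun x hx => by rw [hweq x hx]; ring) x hx 1 h1
    simp only [hfix] at h
    linarith

end FunctionalEquations

section Diffeomorphisms

/-- `F` is differentiable on `[0,1]` with positive derivative `F₁` of class `C^{n+α}`. -/
structure IsHolderImmersion (α : ℝ) (n : ℕ) (F F₁ : ℝ → ℝ) : Prop where
  hasDeriv : ∀ x ∈ I01, HasDerivWithinAt F (F₁ x) I01 x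
  pos : ∀ x ∈ I01, 0 < F₁ x
  holder : HolderDiff α n F₁

variable {α : ℝ} {n : ℕ} {F F₁ G G₁ θ : ℝ → ℝ}

lemma HolderDiff.of_le {m : ℕ} {f : ℝ → ℝ} (hα : 0 < α) (hα1 : α ≤ 1) (hmn : m ≤ n)
    (hf : HolderDiff α n f) : HolderDiff α m f := by
  induction n, hmn using Nat.le_induction with
  | base => exact hf
  | succ n _ ih => exact ih (hf.of_succ hα hα1)

lemma IsHolderImmersion.holderDiff (hF : IsHolderImmersion α n F F₁) : HolderDiff α (n + 1) F :=
  ⟨F₁, hF.hasDeriv, hF.holder⟩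

lemma IsHolderImmersion.strictMonoOn (hF : IsHolderImmersion α n F F₁) : StrictMonoOn F I01 :=
  strictMonoOn_I01_of_deriv_pos hF.hasDeriv hF.pos

lemma IsHolderImmersion.exists_lipschitz (hα : 0 < α) (hF : IsHolderImmersion α n F F₁) :
    ∃ K, ∀ x ∈ I01, ∀ y ∈ I01, |F x - F y| ≤ K * |x - y| := by
  obtain ⟨K, -, hK⟩ := exists_bound_of_continuousOn (hF.holder.continuousOn hα)
  exact ⟨K, abs_sub_le_of_hasDerivWithinAt hF.hasDeriv hK⟩

lemma IsHolderImmersion.const_mul (hα : 0 < α) (hα1 : α ≤ 1) {c : ℝ} (hc : 0 < c)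
    (hF : IsHolderImmersion α n F F₁) :
    IsHolderImmersion α n (fun x => c * F x) fun x => c * F₁ x :=
  ⟨fun x hx => (hF.hasDeriv x hx).const_mul c, fun x hx => mul_pos hc (hF.pos x hx),
    hF.holder.const_mul hα hα1 c⟩

lemma IsHolderImmersion.comp (hα : 0 < α) (hα1 : α ≤ 1) (hF : IsHolderImmersion α n F F₁)
    (hG : IsHolderImmersion α n G G₁) (hmaps : MapsTo G I01 I01) :
    IsHolderImmersion α n (fun x => F (G x)) fun x => F₁ (G x) * G₁ x := by
  obtain ⟨K, hK⟩ := hG.exists_lipschitz hα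
  exact ⟨fun x hx => (hF.hasDeriv _ (hmaps hx)).comp x (hG.hasDeriv x hx) hmaps,
    fun x hx => mul_pos (hF.pos _ (hmaps hx)) (hG.pos x hx),
    (hF.holder.comp hα hα1 (hG.holderDiff.of_succ hα hα1) hmaps hK).mul hα hα1 hG.holder⟩

lemma IsHolderImmersion.exists_expanding (hα : 0 < α) (hF : IsHolderImmersion α n F F₁) :
    ∃ m, 0 < m ∧ ∀ x ∈ I01, ∀ y ∈ I01, m * |x - y| ≤ |F x - F y| := by
  obtain ⟨m, m0, hm⟩ := exists_pos_le_of_continuousOn (hF.holder.continuousOn hα) hF.pos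
  have key : ∀ x ∈ I01, ∀ y ∈ I01, x < y → m * |x - y| ≤ |F x - F y| := by
    intro x hx y hy hxy
    obtain ⟨c, hc, h⟩ := exists_slope_eq_deriv hF.hasDeriv hx hy hxy
    have hcI : c ∈ I01 := ⟨hx.1.trans hc.1.le, hc.2.le.trans hy.2⟩
    rw [abs_sub_comm x, abs_sub_comm (F x), h, abs_mul, abs_of_pos (hF.pos c hcI)]
    exact mul_le_mul_of_nonneg_right (hm c hcI) (abs_nonneg _)
  refine ⟨m, m0, fun x hx y hy => ?_⟩
  rcases lt_trichotomy x y with h | rfl | h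
  · exact key x hx y hy h
  · simp
  · rw [abs_sub_comm x, abs_sub_comm (F x)]; exact key y hy x hx h

/-- A right inverse of a `C^{n+1+α}` immersion is a `C^{n+1+α}` immersion. -/
lemma IsHolderImmersion.rightInverse (hα : 0 < α) (hα1 : α ≤ 1)
    (hF : IsHolderImmersion α n F F₁) (hmaps : MapsTo θ I01 I01) (hθ : ∀ y ∈ I01, F (θ y) = y) :
    IsHolderImmersion α n θ fun y => (F₁ (θ y))⁻¹ := by
  obtain ⟨m, m0, hm⟩ := hF.exists_expanding hα
  have hLip : ∀ x ∈ I01, ∀ y ∈ I01, |θ x - θ y| ≤ m⁻¹ * |x - y| := by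
    intro x hx y hy
    have h := hm _ (hmaps hx) _ (hmaps hy)
    rw [hθ x hx, hθ y hy] at h
    rwa [inv_mul_eq_div, le_div_iff₀' m0]
  have h0 : HolderDiff α 0 θ := holderDiff_zero_of_lipschitz hα1 hLip
  have hderiv : ∀ y ∈ I01, HasDerivWithinAt θ (F₁ (θ y))⁻¹ I01 y := by
    intro y hy
    have htend : Tendsto θ (nhdsWithin y I01) (nhdsWithin (θ y) I01) :=
      (h0.continuousOn hα y hy).tendsto_nhdsWithin hmaps
    have hne := (hF.pos _ (hmaps hy)).ne'
    have hFd : HasFDerivWithinAt F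
        ((ContinuousLinearEquiv.unitsEquivAut ℝ (Units.mk0 _ hne) : ℝ ≃L[ℝ] ℝ) : ℝ →L[ℝ] ℝ)
        I01 (θ y) := by
      refine (hF.hasDeriv _ (hmaps hy)).hasFDerivWithinAt.congr_fderiv ?_
      ext
      simp
    have h := (hFd.of_local_left_inverse htend hy
      (eventually_nhdsWithin_of_forall hθ)).hasDerivWithinAt
    simpa using h
  have hreg : ∀ m ≤ n + 1, HolderDiff α m θ := by
    intro m
    induction m with
    | zero => exact fun _ => h0
    | succ m ih =>
      intro hmn
      exact ⟨_, hderiv, ((hF.holder.of_le hα hα1 (by omega)).comp hα hα1 (ih (by omega)) hmaps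
        hLip).inv hα hα1 fun y hy => hF.pos _ (hmaps hy)⟩
  exact ⟨hderiv, fun y hy => inv_pos.2 (hF.pos _ (hmaps hy)),
    (hF.holder.comp hα hα1 (hreg n (by omega)) hmaps hLip).inv hα hα1
      fun y hy => hF.pos _ (hmaps hy)⟩

lemma IsHolderImmersion.exists_inverse (hα : 0 < α) (hα1 : α ≤ 1)
    (hF : IsHolderImmersion α n F F₁) (hF0 : F 0 = 0) (hF1 : F 1 = 1) :
    ∃ θ θ₁ : ℝ → ℝ, IsHolderImmersion α n θ θ₁ ∧ MapsTo θ I01 I01 ∧ (∀ y ∈ I01, F (θ y) = y) ∧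
      ∀ x ∈ I01, θ (F x) = x := by
  have hsurj : ∀ y : ℝ, ∃ x ∈ I01, y ∈ I01 → F x = y := by
    intro y
    by_cases hy : y ∈ I01
    · obtain ⟨x, hx, h⟩ := intermediate_value_Icc zero_le_one
        (hF.holderDiff.continuousOn hα) (by rwa [hF0, hF1])
      exact ⟨x, hx, fun _ => h⟩
    · exact ⟨0, by simp, fun h => absurd h hy⟩
  choose θ hmaps hθ using hsurj
  have hFmaps : MapsTo F I01 I01 := fun x hx => by
    have hm := hF.strictMonoOn.monotoneOn
    exact ⟨hF0 ▸ hm (by simp) hx hx.1, hF1 ▸ hm hx (by simp) hx.2⟩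
  refine ⟨θ, _, hF.rightInverse hα hα1 (fun y _ => hmaps y) hθ, fun y _ => hmaps y, hθ,
    fun x hx => ?_⟩
  exact hF.strictMonoOn.injOn (hmaps _) hx (hθ _ (hFmaps hx))

/-- Linearization at the fixed point `1` of a `C^{n+1+α}` contraction of `[0,1]`. -/
lemma exists_linearization (hα : 0 < α) (hα1 : α ≤ 1) (hG : IsHolderImmersion α n G G₁)
    (hmaps : MapsTo G I01 I01) (hfix : G 1 = 1) (hlt : ∀ x ∈ I01, G₁ x < 1) :
    ∃ ψ ψ₁ : ℝ → ℝ, IsHolderImmersion α n ψ ψ₁ ∧ ψ 0 = 0 ∧ ψ 1 = 1 ∧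
      ∃ c, 0 < c ∧ ∀ x ∈ I01, ∀ y ∈ I01, ψ (G x) - ψ (G y) = c * (ψ x - ψ y) := by
  have h0 : (0 : ℝ) ∈ I01 := left_mem_Icc.2 zero_le_one
  have h1 : (1 : ℝ) ∈ I01 := right_mem_Icc.2 zero_le_one
  obtain ⟨l, hl1, hl⟩ := exists_lt_one_of_continuousOn (hG.holder.continuousOn hα) hlt
  have hl0 : 0 ≤ l := (hG.pos 0 h0).le.trans (hl 0 h0)
  obtain ⟨Φ, hΦ, hΦeq⟩ := exists_holderDiff_coboundary hα hα1 hG.hasDeriv hmaps hfix hl0 hl1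
    (fun x hx => by rw [abs_of_pos (hG.pos x hx)]; exact hl x hx) hG.holder
    (hG.holder.log hα hα1 hG.pos)
  obtain ⟨V, hV⟩ := exists_antideriv ((hΦ.exp hα hα1).continuousOn hα)
  have hVi : IsHolderImmersion α n V fun x => Real.exp (Φ x) :=
    ⟨hV, fun x _ => Real.exp_pos _, hΦ.exp hα hα1⟩
  have hV01 : 0 < V 1 - V 0 := sub_pos.2 (hVi.strictMonoOn h0 h1 one_pos)
  have hscale := hVi.const_mul hα hα1 (inv_pos.2 hV01)
  refine ⟨fun x => (V 1 - V 0)⁻¹ * (V x - V 0), _,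
    ⟨fun x hx => ((hV x hx).sub_const _).const_mul _, hscale.pos, hscale.holder⟩, by simp,
    inv_mul_cancel₀ hV01.ne', G₁ 1, hG.pos 1 h1, fun x hx y hy => ?_⟩
  have hder : ∀ x ∈ I01, HasDerivWithinAt (fun x => V (G x) - G₁ 1 * V x)
      (Real.exp (Φ (G x)) * G₁ x - G₁ 1 * Real.exp (Φ x)) I01 x := fun x hx =>
    ((hV _ (hmaps hx)).comp x (hG.hasDeriv x hx) hmaps).sub ((hV x hx).const_mul _)
  have h := eq_of_hasDerivWithinAt_zero hder (fun x hx => by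
    have e : Real.exp (Φ x) = G₁ x / G₁ 1 * Real.exp (Φ (G x)) := by
      rw [hΦeq x hx, Real.exp_add, Real.exp_sub, Real.exp_log (hG.pos x hx),
        Real.exp_log (hG.pos 1 h1)]
    have := (hG.pos 1 h1).ne'
    rw [e]
    field_simp
    ring) x hx y hy
  linear_combination (V 1 - V 0)⁻¹ * h

/-- Iterating a contraction that is linear in the coordinate `ψ` computes ratios of lengths
measured by `ψ`. -/
lemma tendsto_ratio_of_linearization {ψ ψ₁ : ℝ → ℝ} {l c : ℝ} (hα : 0 < α)
    (hψ : IsHolderImmersion α n ψ ψ₁) (hG : ∀ x ∈ I01, HasDerivWithinAt G (G₁ x) I01 x)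
    (hmaps : MapsTo G I01 I01) (hfix : G 1 = 1) (hl0 : 0 ≤ l) (hl1 : l < 1)
    (hl : ∀ x ∈ I01, |G₁ x| ≤ l) (hc : 0 < c)
    (hlin : ∀ x ∈ I01, ∀ y ∈ I01, ψ (G x) - ψ (G y) = c * (ψ x - ψ y))
    {x y x' y' : ℝ} (hx : x ∈ I01) (hy : y ∈ I01) (hx' : x' ∈ I01) (hy' : y' ∈ I01)
    (hxy : x < y) (hxy' : x' < y') :
    Tendsto (fun m : ℕ => (G^[m] y - G^[m] x) / (G^[m] y' - G^[m] x')) atTop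
      (nhds ((ψ y - ψ x) / (ψ y' - ψ x'))) := by
  have h1 : (1 : ℝ) ∈ I01 := right_mem_Icc.2 zero_le_one
  have hiter : ∀ m : ℕ, ∀ x ∈ I01, ∀ y ∈ I01,
      ψ (G^[m] x) - ψ (G^[m] y) = c ^ m * (ψ x - ψ y) := by
    intro m
    induction m with
    | zero => intro x _ y _; simp
    | succ m ih =>
      intro x hx y hy
      rw [Function.iterate_succ_apply', Function.iterate_succ_apply',
        hlin _ (hmaps.iterate m hx) _ (hmaps.iterate m hy), ih x hx y hy, pow_succ']
      ring
  have hmean : ∀ x ∈ I01, ∀ y ∈ I01, x < y → ∃ ξ : ℕ → ℝ, (∀ m, ξ m ∈ I01) ∧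
      Tendsto (fun m => ψ₁ (ξ m)) atTop (nhds (ψ₁ 1)) ∧
      ∀ m, G^[m] y - G^[m] x = c ^ m * (ψ y - ψ x) / ψ₁ (ξ m) := by
    intro x hx y hy hxy
    have hex : ∀ m : ℕ, ∃ ξ ∈ I01, G^[m] x ≤ ξ ∧
        G^[m] y - G^[m] x = c ^ m * (ψ y - ψ x) / ψ₁ ξ := by
      intro m
      have hxm := hmaps.iterate m hx
      have hym := hmaps.iterate m hy
      have hψlt : ψ (G^[m] x) < ψ (G^[m] y) := by
        rw [← sub_pos, hiter m y hy x hx]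
        exact mul_pos (pow_pos hc m) (sub_pos.2 (hψ.strictMonoOn hx hy hxy))
      have hlt := (hψ.strictMonoOn.lt_iff_lt hxm hym).1 hψlt
      obtain ⟨ξ, hξ, h⟩ := exists_slope_eq_deriv hψ.hasDeriv hxm hym hlt
      have hξI : ξ ∈ I01 := ⟨hxm.1.trans hξ.1.le, hξ.2.le.trans hym.2⟩
      refine ⟨ξ, hξI, hξ.1.le, ?_⟩
      rw [eq_div_iff (hψ.pos ξ hξI).ne', ← hiter m y hy x hx, h, mul_comm]
    choose ξ hξI hξ hξeq using hex
    have hlim : Tendsto ξ atTop (nhds 1) := by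
      have hlow : Tendsto (fun m : ℕ => 1 - l ^ m) atTop (nhds 1) := by
        simpa using (tendsto_pow_atTop_nhds_zero_of_lt_one hl0 hl1).const_sub 1
      refine tendsto_of_tendsto_of_tendsto_of_le_of_le hlow tendsto_const_nhds (fun m => ?_)
        fun m => (hξI m).2
      have h := abs_iterate_sub_one_le hG hmaps hfix hl0 hl m x hx
      have := (abs_le.1 h).1
      simp only
      linarith [hξ m]
    exact ⟨ξ, hξI, (hψ.holder.continuousOn hα 1 h1).tendsto.comp
      (tendsto_nhdsWithin_iff.2 ⟨hlim, Eventually.of_forall hξI⟩), hξeq⟩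
  obtain ⟨ξ, hξI, hξlim, hξeq⟩ := hmean x hx y hy hxy
  obtain ⟨η, hηI, hηlim, hηeq⟩ := hmean x' hx' y' hy' hxy'
  have hp1 := (hψ.pos 1 h1).ne'
  have hlim : Tendsto (fun m => (ψ y - ψ x) / (ψ y' - ψ x') * (ψ₁ (η m) / ψ₁ (ξ m))) atTop
      (nhds ((ψ y - ψ x) / (ψ y' - ψ x') * (ψ₁ 1 / ψ₁ 1))) :=
    (hηlim.div hξlim hp1).const_mul _
  rw [div_self hp1, mul_one] at hlim
  refine hlim.congr fun m => ?_
  have e1 := (hψ.pos _ (hξI m)).ne'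
  have e2 := (hψ.pos _ (hηI m)).ne'
  have e3 := (sub_pos.2 (hψ.strictMonoOn hx' hy' hxy')).ne'
  have e4 := (pow_pos hc m).ne'
  rw [hξeq, hηeq]
  field_simp

lemma eq_zero_of_frequently_eq_rpow {C p : ℝ} {P : ℝ → ℝ} (hp : 0 < p)
    (hcont : ContinuousWithinAt P I01 0) (hP : ∀ δ > 0, ∃ x ∈ Ioo 0 δ, P x = C * x ^ p) :
    P 0 = 0 := by
  choose x hx hxP using fun m : ℕ => hP (1 / ((m : ℝ) + 1)) (by positivity)
  have hx0 : Tendsto x atTop (nhds 0) :=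
    squeeze_zero (fun m => (hx m).1.le) (fun m => (hx m).2.le)
      tendsto_one_div_add_atTop_nhds_zero_nat
  have hxI : ∀ m, x m ∈ I01 := fun m => ⟨(hx m).1.le, (hx m).2.le.trans
    ((div_le_one (by positivity)).2 (by linarith [m.cast_nonneg (α := ℝ)]))⟩
  have hl1 : Tendsto (fun m => P (x m)) atTop (nhds (P 0)) :=
    hcont.tendsto.comp (tendsto_nhdsWithin_iff.2 ⟨hx0, Eventually.of_forall hxI⟩)
  have hl2 : Tendsto (fun m => C * x m ^ p) atTop (nhds (C * 0 ^ p)) :=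
    (hx0.rpow_const (Or.inr hp.le)).const_mul C
  rw [Real.zero_rpow hp.ne', mul_zero] at hl2
  exact tendsto_nhds_unique (hl1.congr hxP) hl2

/-- A function of class `C^{n+ε₁}` cannot agree with a positive multiple of `x^{n+ε}`, `ε < ε₁`,
at points accumulating at `0`. -/
lemma not_holderDiff_of_frequently_eq_rpow {ε ε₁ C : ℝ} {P : ℝ → ℝ} (hε : 0 < ε) (hεε : ε < ε₁)
    (hC : 0 < C) (hP : ∀ δ > 0, ∃ x ∈ Ioo 0 δ, P x = C * x ^ ((n : ℝ) + ε)) :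
    ¬ HolderDiff ε₁ n P := by
  intro hH
  have h0 : (0 : ℝ) ∈ I01 := left_mem_Icc.2 zero_le_one
  induction n generalizing P C with
  | zero =>
    have hP0 := eq_zero_of_frequently_eq_rpow (by simpa using hε)
      (hH.continuousOn (hε.trans hεε) 0 h0) hP
    obtain ⟨H, -, hH⟩ := hH
    have hlim : Tendsto (fun x : ℝ => H * x ^ (ε₁ - ε)) (nhds 0) (nhds 0) := by
      have h : Continuous fun x : ℝ => H * x ^ (ε₁ - ε) :=
        continuous_const.mul (continuous_id.rpow_const fun _ => Or.inr (sub_pos.2 hεε).le)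
      simpa [Real.zero_rpow (sub_pos.2 hεε).ne'] using h.tendsto 0
    obtain ⟨δ, δ0, hδ⟩ := Metric.eventually_nhds_iff.1 (hlim.eventually (gt_mem_nhds hC))
    obtain ⟨x, hx, hxP⟩ := hP (min δ 1) (lt_min δ0 one_pos)
    have hx1 : x ∈ I01 := ⟨hx.1.le, (hx.2.trans_le (min_le_right _ _)).le⟩
    have hlt := hδ (y := x) (by
      rw [Real.dist_eq, sub_zero, abs_of_pos hx.1]; exact hx.2.trans_le (min_le_left _ _))
    have h := (le_abs_self _).trans (hH x hx1 0 h0)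
    rw [hP0, hxP, sub_zero, sub_zero, abs_of_pos hx.1, Nat.cast_zero, zero_add] at h
    rw [Real.rpow_sub hx.1, ← mul_div_assoc, div_lt_iff₀ (Real.rpow_pos_of_pos hx.1 _)] at hlt
    linarith
  | succ n ih =>
    have h1 : (1 : ℝ) ≤ ((n + 1 : ℕ) : ℝ) + ε := by push_cast; linarith [n.cast_nonneg (α := ℝ)]
    have hP0 := eq_zero_of_frequently_eq_rpow (one_pos.trans_le h1)
      (hH.continuousOn (hε.trans hεε) 0 h0) hP
    obtain ⟨P', hd, hP'⟩ := hH
    refine ih (C := C * ((n : ℝ) + 1 + ε)) (P := P') (by positivity) (fun δ hδ => ?_) hP'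
    obtain ⟨x, hx, hxP⟩ := hP (min δ 1) (lt_min hδ one_pos)
    have hx1 : x ∈ I01 := ⟨hx.1.le, (hx.2.trans_le (min_le_right _ _)).le⟩
    have hder : ∀ t ∈ I01, HasDerivWithinAt (fun t => P t - C * t ^ (((n + 1 : ℕ) : ℝ) + ε))
        (P' t - C * ((n : ℝ) + 1 + ε) * t ^ ((n : ℝ) + ε)) I01 t := by
      intro t ht
      have h := (Real.hasDerivAt_rpow_const (x := t) (Or.inr h1)).hasDerivWithinAt (s := I01)
      refine ((hd t ht).sub (h.const_mul C)).congr_deriv ?_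
      rw [show ((n + 1 : ℕ) : ℝ) + ε - 1 = n + ε by push_cast; ring]
      push_cast
      ring
    obtain ⟨c, hc, hslope⟩ := exists_slope_eq_deriv hder h0 hx1 hx.1
    refine ⟨c, ⟨hc.1, hc.2.trans (hx.2.trans_le (min_le_left _ _))⟩, ?_⟩
    rw [hxP, hP0, Real.zero_rpow (one_pos.trans_le h1).ne', mul_zero, sub_self, sub_zero,
      sub_zero, eq_comm, mul_eq_zero] at hslope
    exact sub_eq_zero.1 (hslope.resolve_right (by simpa using hx.1.ne'))

end Diffeomorphisms

section CantorSystems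

variable {d : ℕ} {α : ℝ} {n : ℕ} {g : Fin d → ℝ → ℝ}

lemma IsCantorSystem.isHolderImmersion (hα : 0 < α) (hg : IsCantorSystem (n + 1) α g)
    (i : Fin d) : IsHolderImmersion α n (g i) (derivWithin (g i) I01) := by
  obtain ⟨f', hf, hf'⟩ := (holderDiff_iff hα).2 ⟨hg.smooth i, hg.holder i⟩
  have heq : EqOn (derivWithin (g i) I01) f' I01 := fun x hx =>
    (hf x hx).derivWithin (uniqueDiffOn_Icc one_pos x hx)
  exact ⟨fun x hx => (hf x hx).congr_deriv (heq hx).symm, hg.deriv_pos i, hf'.congr heq⟩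

lemma isCantorSystem_of_isHolderImmersion {g₁ : Fin d → ℝ → ℝ} (hα : 0 < α)
    (hg : ∀ i, IsHolderImmersion α n (g i) (g₁ i)) (hmaps : ∀ i, MapsTo (g i) I01 I01)
    (hlt : ∀ i, ∀ x ∈ I01, g₁ i x < 1) (hord : ∀ i j : Fin d, i < j → g i 1 < g j 0)
    (hfirst : ∀ i : Fin d, (i : ℕ) = 0 → g i 0 = 0)
    (hlast : ∀ i : Fin d, (i : ℕ) = d - 1 → g i 1 = 1) : IsCantorSystem (n + 1) α g := by
  have hd : ∀ i, ∀ x ∈ I01, derivWithin (g i) I01 x = g₁ i x := fun i x hx =>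
    ((hg i).hasDeriv x hx).derivWithin (uniqueDiffOn_Icc one_pos x hx)
  have h := fun i => (holderDiff_iff hα).1 (hg i).holderDiff
  exact ⟨hmaps, fun i => (h i).1, fun i => (h i).2, fun i x hx => by
    rw [hd i x hx]; exact (hg i).pos x hx, fun i x hx => by rw [hd i x hx]; exact hlt i x hx,
    hord, hfirst, hlast⟩

lemma wordMap_append (u v : List (Fin d)) (x : ℝ) :
    wordMap g (u ++ v) x = wordMap g v (wordMap g u x) := by
  induction u generalizing x with
  | nil => rfl
  | cons i u ih => exact ih (g i x)

lemma wordMap_replicate (i : Fin d) (m : ℕ) : wordMap g (List.replicate m i) = (g i)^[m] := by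
  induction m with
  | zero => rfl
  | succ m ih => ext x; rw [List.replicate_succ, wordMap, ih, Function.iterate_succ_apply]

lemma dword_succ (j : ℕ → Fin d) (m : ℕ) : dword j (m + 1) = dword j m ++ [j m] := by
  rw [dword, List.ofFn_succ', List.concat_eq_append]
  rfl

lemma wordMap_dword_succ (j : ℕ → Fin d) (m : ℕ) (x : ℝ) :
    wordMap g (dword j (m + 1)) x = g (j m) (wordMap g (dword j m) x) := by
  rw [dword_succ, wordMap_append]
  rfl

lemma dword_ite (i l : Fin d) (m p : ℕ) :
    dword (fun t => if t < m then i else l) (m + p) =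
      List.replicate m i ++ List.replicate p l := by
  rw [dword, List.ofFn_add]
  simp

lemma mapsTo_wordMap (hmaps : ∀ i, MapsTo (g i) I01 I01) (w : List (Fin d)) :
    MapsTo (wordMap g w) I01 I01 := by
  induction w with
  | nil => exact mapsTo_id I01
  | cons i w ih => exact fun x hx => ih (hmaps i hx)

lemma strictMonoOn_wordMap (hmaps : ∀ i, MapsTo (g i) I01 I01)
    (hmono : ∀ i, StrictMonoOn (g i) I01) (w : List (Fin d)) :
    StrictMonoOn (wordMap g w) I01 := by
  induction w with
  | nil => exact strictMonoOn_id
  | cons i w ih => exact ih.comp (hmono i) (hmaps i)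

/-- Ratios of lengths converge under longer and longer compositions of branches. -/
lemma IsCantorSystem.exists_tendsto_ratio (hα : 0 < α) (hα1 : α ≤ 1)
    (hg : IsCantorSystem (n + 1) α g) (j : ℕ → Fin d) {a b : ℝ} (ha : a ∈ I01) (hb : b ∈ I01)
    (hab : a < b) :
    ∃ r, Tendsto (fun m => (wordMap g (dword j m) b - wordMap g (dword j m) a) /
      wordLen g (dword j m)) atTop (nhds r) := by
  have h0 : (0 : ℝ) ∈ I01 := left_mem_Icc.2 zero_le_one
  have h1 : (1 : ℝ) ∈ I01 := right_mem_Icc.2 zero_le_one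
  have him := hg.isHolderImmersion hα
  have hcont := fun i => (him i).holder.continuousOn hα
  choose l hl1 hl using fun i => exists_lt_one_of_continuousOn (hcont i) (hg.deriv_lt_one i)
  choose c hc0 hc using fun i => exists_pos_le_of_continuousOn (hcont i) (hg.deriv_pos i)
  choose H hH0 hH using fun i => (him i).holder.of_le hα hα1 n.zero_le
  obtain ⟨⟨L, hL1⟩, hL⟩ := Finite.exists_le fun i => (⟨l i, hl1 i⟩ : Iio (1 : ℝ))
  obtain ⟨⟨C, hC0⟩, hC⟩ := Finite.exists_ge fun i => (⟨c i, hc0 i⟩ : Ioi (0 : ℝ))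
  obtain ⟨K, hK⟩ := Finite.exists_le H
  replace hL1 : L < 1 := hL1
  replace hC0 : 0 < C := hC0
  replace hL : ∀ i, ∀ x ∈ I01, derivWithin (g i) I01 x ≤ L := fun i x hx =>
    (hl i x hx).trans (hL i)
  replace hC : ∀ i, ∀ x ∈ I01, C ≤ derivWithin (g i) I01 x := fun i x hx =>
    (show C ≤ c i from hC i).trans (hc i x hx)
  have hL0 : 0 ≤ L := (hC0.le.trans (hC (j 0) 0 h0)).trans (hL (j 0) 0 h0)
  have hK0 : 0 ≤ K := (hH0 (j 0)).trans (hK (j 0))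
  set G : ℕ → ℝ → ℝ := fun m => wordMap g (dword j m) with hGdef
  have hGm : ∀ m, MapsTo (G m) I01 I01 := fun m => mapsTo_wordMap hg.maps _
  have hGs : ∀ m, StrictMonoOn (G m) I01 := fun m =>
    strictMonoOn_wordMap hg.maps (fun i => (him i).strictMonoOn) _
  have hstep : ∀ m x, G (m + 1) x = g (j m) (G m x) := fun m x => wordMap_dword_succ j m x
  have hlen : ∀ m, G m 1 - G m 0 ≤ L ^ m := by
    intro m
    induction m with
    | zero => simp [hGdef, dword, wordMap]
    | succ m ih =>
      have hlt := hGs m h0 h1 one_pos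
      obtain ⟨η, hη, h⟩ := exists_slope_eq_deriv (him (j m)).hasDeriv (hGm m h0) (hGm m h1) hlt
      have hηI : η ∈ I01 := ⟨(hGm m h0).1.trans hη.1.le, hη.2.le.trans (hGm m h1).2⟩
      rw [hstep, hstep, h, pow_succ']
      exact mul_le_mul (hL _ η hηI) ih (sub_nonneg.2 hlt.le) hL0
  refine cauchySeq_tendsto_of_complete (cauchySeq_of_le_geometric (L ^ α) (K / C)
    (Real.rpow_lt_one hL0 hL1 hα) fun m => ?_)
  have hlt := hGs m h0 h1 one_pos
  obtain ⟨η, hη, hη'⟩ := exists_slope_eq_deriv (him (j m)).hasDeriv (hGm m h0) (hGm m h1) hlt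
  obtain ⟨ξ, hξ, hξ'⟩ :=
    exists_slope_eq_deriv (him (j m)).hasDeriv (hGm m ha) (hGm m hb) (hGs m ha hb hab)
  have hηI : η ∈ I01 := ⟨(hGm m h0).1.trans hη.1.le, hη.2.le.trans (hGm m h1).2⟩
  have hξI : ξ ∈ I01 := ⟨(hGm m ha).1.trans hξ.1.le, hξ.2.le.trans (hGm m hb).2⟩
  have ha0 : G m 0 ≤ G m a := (hGs m).monotoneOn h0 ha ha.1
  have hb1 : G m b ≤ G m 1 := (hGs m).monotoneOn hb h1 hb.2
  have hdist : |ξ - η| ≤ L ^ m := by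
    refine le_trans ?_ (hlen m)
    rw [abs_le]
    constructor <;> linarith [hξ.1, hξ.2, hη.1, hη.2]
  have hpos : 0 < G m 1 - G m 0 := sub_pos.2 hlt
  have hr0 : 0 ≤ (G m b - G m a) / (G m 1 - G m 0) :=
    div_nonneg (sub_nonneg.2 (hGs m ha hb hab).le) hpos.le
  have hr1 : (G m b - G m a) / (G m 1 - G m 0) ≤ 1 := (div_le_one hpos).2 (by linarith)
  change dist ((G m b - G m a) / (G m 1 - G m 0))
    ((G (m + 1) b - G (m + 1) a) / (G (m + 1) 1 - G (m + 1) 0)) ≤ _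
  have hηpos := hg.deriv_pos (j m) η hηI
  rw [hstep, hstep, hstep, hstep, hη', hξ', mul_div_mul_comm, dist_comm, Real.dist_eq]
  have hfac : derivWithin (g (j m)) I01 ξ / derivWithin (g (j m)) I01 η *
      ((G m b - G m a) / (G m 1 - G m 0)) - (G m b - G m a) / (G m 1 - G m 0) =
      (derivWithin (g (j m)) I01 ξ - derivWithin (g (j m)) I01 η) /
        derivWithin (g (j m)) I01 η * ((G m b - G m a) / (G m 1 - G m 0)) := by
    rw [sub_div (derivWithin (g (j m)) I01 ξ), div_self hηpos.ne', sub_mul, one_mul]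
  rw [hfac, abs_mul, abs_of_nonneg hr0, abs_div, abs_of_pos hηpos]
  refine (mul_le_of_le_one_right (by positivity) hr1).trans ?_
  have hnum : |derivWithin (g (j m)) I01 ξ - derivWithin (g (j m)) I01 η| ≤ K * (L ^ α) ^ m := by
    refine (hH (j m) ξ hξI η hηI).trans ?_
    rw [← Real.rpow_natCast (L ^ α), ← Real.rpow_mul hL0, mul_comm α, Real.rpow_mul hL0,
      Real.rpow_natCast]
    exact mul_le_mul (hK _) (Real.rpow_le_rpow (abs_nonneg _) hdist hα.le)
      (Real.rpow_nonneg (abs_nonneg _) _) hK0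
  rw [div_mul_eq_mul_div]
  exact div_le_div₀ (by positivity) hnum hC0 (hC _ η hηI)

theorem IsCantorSystem.exists_hasScalingFunction (hα : 0 < α) (hα1 : α ≤ 1)
    (hg : IsCantorSystem (n + 1) α g) : ∃ S, HasScalingFunction g S := by
  have h0 : (0 : ℝ) ∈ I01 := left_mem_Icc.2 zero_le_one
  have h1 : (1 : ℝ) ∈ I01 := right_mem_Icc.2 zero_le_one
  have key : ∀ (j : ℕ → Fin d) (m : Fin (2 * d - 1)),
      ∃ r, Tendsto (fun p => scalingData g (dword j p) m) atTop (nhds r) := by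
    intro j m
    unfold scalingData
    split_ifs with h
    · exact hg.exists_tendsto_ratio hα hα1 j (hg.maps _ h0) (hg.maps _ h1)
        ((hg.isHolderImmersion hα _).strictMonoOn h0 h1 one_pos)
    · exact hg.exists_tendsto_ratio hα hα1 j (hg.maps _ h1) (hg.maps _ h0)
        (hg.ordered _ _ (Fin.mk_lt_mk.2 (Nat.lt_succ_self _)))
  choose S hS using key
  exact ⟨S, fun j => tendsto_pi_nhds.2 (hS j)⟩

/-- The scaling function along words `i₀ ⋯ i₀ l l ⋯` determines the positions of the points
`g_{i₀}^m(1)` in a coordinate linearizing the last branch. -/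
lemma IsCantorSystem.linearization_ratio {S : (ℕ → Fin d) → Fin (2*d-1) → ℝ} {i₀ l : Fin d}
    {ψ ψ₁ : ℝ → ℝ} {c : ℝ} (hα : 0 < α) (hg : IsCantorSystem (n + 1) α g)
    (hS : HasScalingFunction g S) (hi₀ : (i₀ : ℕ) = 0) (hl : (l : ℕ) = d - 1)
    (hψ : IsHolderImmersion α n ψ ψ₁) (hψ0 : ψ 0 = 0) (hc : 0 < c)
    (hlin : ∀ x ∈ I01, ∀ y ∈ I01, ψ (g l x) - ψ (g l y) = c * (ψ x - ψ y))
    (p : Fin (2 * d - 1)) (hp : (p : ℕ) = 0) (m : ℕ) :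
    ψ ((g i₀)^[m + 1] 1) / ψ ((g i₀)^[m] 1) = S (fun t => if t < m then i₀ else l) p := by
  have h0 : (0 : ℝ) ∈ I01 := left_mem_Icc.2 zero_le_one
  have h1 : (1 : ℝ) ∈ I01 := right_mem_Icc.2 zero_le_one
  have him := hg.isHolderImmersion hα
  obtain ⟨q, hq1, hq⟩ :=
    exists_lt_one_of_continuousOn ((him l).holder.continuousOn hα) (hg.deriv_lt_one l)
  have hfix0 : ∀ m, (g i₀)^[m] 0 = 0 := fun m =>
    Function.iterate_fixed (hg.first i₀ hi₀) m
  have hmem : ∀ m, (g i₀)^[m] 1 ∈ I01 := fun m => (hg.maps i₀).iterate m h1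
  have hpos : ∀ m, 0 < (g i₀)^[m] 1 := by
    intro m
    have h := strictMonoOn_wordMap hg.maps (fun i => (him i).strictMonoOn)
      (List.replicate m i₀) h0 h1 one_pos
    rwa [wordMap_replicate, hfix0] at h
  have hlim := tendsto_ratio_of_linearization hα hψ (him l).hasDeriv (hg.maps l)
    (hg.last l hl) ((hg.deriv_pos l 0 h0).le.trans (hq 0 h0)) hq1
    (fun x hx => by rw [abs_of_pos (hg.deriv_pos l x hx)]; exact hq x hx) hc hlin
    h0 (hmem (m + 1)) h0 (hmem m) (hpos (m + 1)) (hpos m)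
  rw [hψ0, sub_zero, sub_zero] at hlim
  refine tendsto_nhds_unique hlim ?_
  have hS' := (tendsto_pi_nhds.1 (hS fun t => if t < m then i₀ else l) p).comp
    (tendsto_add_atTop_nat m)
  refine hS'.congr fun t => ?_
  have hpd : (p : ℕ) < d := hp ▸ hi₀ ▸ i₀.isLt
  have hip : (⟨(p : ℕ), hpd⟩ : Fin d) = i₀ := Fin.ext (hp.trans hi₀.symm)
  simp only [Function.comp_apply, add_comm t m, dword_ite, scalingData, dif_pos hpd, hip, wordLen,
    wordMap, wordMap_append, wordMap_replicate, hg.first i₀ hi₀, hfix0, Function.iterate_succ_apply]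

lemma isHolderImmersion_linear_add_rpow {ε a b : ℝ} (hε : 0 < ε) (hε1 : ε ≤ 1) (ha : 0 < a)
    (hb : 0 < b) (n : ℕ) :
    IsHolderImmersion ε n (fun x => a * x + b * x ^ (((n + 1 : ℕ) : ℝ) + ε))
      fun x => a + b * (((n + 1 : ℕ) : ℝ) + ε) * x ^ ((n : ℝ) + ε) := by
  have h1 : (1 : ℝ) ≤ ((n + 1 : ℕ) : ℝ) + ε := by push_cast; linarith [n.cast_nonneg (α := ℝ)]
  refine ⟨fun x _ => ?_, fun x hx => ?_,
    (holderDiff_const a).add ((holderDiff_rpow hε hε1 n).const_mul hε hε1 _)⟩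
  · have h := (Real.hasDerivAt_rpow_const (x := x) (Or.inr h1)).hasDerivWithinAt (s := I01)
    refine (((hasDerivWithinAt_id x I01).const_mul a).add (h.const_mul b)).congr_deriv ?_
    rw [show ((n + 1 : ℕ) : ℝ) + ε - 1 = n + ε by push_cast; ring]
    ring
  · have := Real.rpow_nonneg hx.1 ((n : ℝ) + ε)
    positivity

/-- A system with affine last branch whose first branch inverts `a x + b x^{n+1+ε}` does not share
its scaling function with a smoother system. -/
theorem not_hasScalingFunction_of_smoother {S : (ℕ → Fin d) → Fin (2*d-1) → ℝ} {i₀ l : Fin d}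
    {g' : Fin d → ℝ → ℝ} {ε ε₁ a b c : ℝ} (hε : 0 < ε) (hεε : ε < ε₁) (hε₁ : ε₁ ≤ 1)
    (hg : IsCantorSystem (n + 1) ε g) (hS : HasScalingFunction g S) (hi₀ : (i₀ : ℕ) = 0)
    (hl : (l : ℕ) = d - 1) (ha : 1 < a) (hb : 0 < b) (hc : 0 < c)
    (hlast : ∀ x ∈ I01, ∀ y ∈ I01, g l x - g l y = c * (x - y))
    (hfirst : ∀ y ∈ I01, a * g i₀ y + b * g i₀ y ^ (((n + 1 : ℕ) : ℝ) + ε) = y)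
    (hg' : IsCantorSystem (n + 1) ε₁ g') : ¬ HasScalingFunction g' S := by
  intro hS'
  have h0 : (0 : ℝ) ∈ I01 := left_mem_Icc.2 zero_le_one
  have h1 : (1 : ℝ) ∈ I01 := right_mem_Icc.2 zero_le_one
  have hε₁0 : 0 < ε₁ := hε.trans hεε
  have him := hg.isHolderImmersion hε
  have him' := hg'.isHolderImmersion hε₁0
  let p : Fin (2 * d - 1) := ⟨0, by have := i₀.isLt; omega⟩
  have hid : IsHolderImmersion ε n (fun x => x) fun _ => 1 :=
    ⟨fun x _ => hasDerivWithinAt_id x I01, fun _ _ => one_pos, holderDiff_const 1⟩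
  obtain ⟨ψ, ψ₁, hψ, hψ0, hψ1, c', hc', hlin⟩ := exists_linearization hε₁0 hε₁ (him' l)
    (hg'.maps l) (hg'.last l hl) (hg'.deriv_lt_one l)
  set u : ℕ → ℝ := fun m => (g i₀)^[m] 1 with hu
  set v : ℕ → ℝ := fun m => (g' i₀)^[m] 1 with hv
  have hu1 : ∀ m, u (m + 1) = g i₀ (u m) := fun m => Function.iterate_succ_apply' _ _ _
  have hv1 : ∀ m, v (m + 1) = g' i₀ (v m) := fun m => Function.iterate_succ_apply' _ _ _
  have huI : ∀ m, u m ∈ I01 := fun m => (hg.maps i₀).iterate m h1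
  have hvI : ∀ m, v m ∈ I01 := fun m => (hg'.maps i₀).iterate m h1
  have hupos : ∀ m, 0 < u m := by
    intro m
    induction m with
    | zero => exact one_pos
    | succ m ih =>
      rw [hu1, ← hg.first i₀ hi₀]
      exact (him i₀).strictMonoOn h0 (huI m) ih
  have hψv : ∀ m, ψ (v m) = u m := by
    intro m
    induction m with
    | zero => exact hψ1
    | succ m ih =>
      have h := (hg'.linearization_ratio hε₁0 hS' hi₀ hl hψ hψ0 hc' hlin p rfl m).trans
        (hg.linearization_ratio hε hS hi₀ hl hid rfl hc hlast p rfl m).symm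
      change ψ (v (m + 1)) / ψ (v m) = u (m + 1) / u m at h
      rwa [ih, div_left_inj' (hupos m).ne'] at h
  have hψmaps : MapsTo ψ I01 I01 := fun x hx =>
    ⟨hψ0 ▸ hψ.strictMonoOn.monotoneOn h0 hx hx.1, hψ1 ▸ hψ.strictMonoOn.monotoneOn hx h1 hx.2⟩
  obtain ⟨θ, θ₁, hθ, hθmaps, -, hθψ⟩ := hψ.exists_inverse hε₁0 hε₁ hψ0 hψ1
  have hσ : 0 < u 1 := hupos 1
  have hθu : ∀ m, θ (u m) = v m := fun m => by rw [← hψv, hθψ _ (hvI m)]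
  have hF := ((hψ.comp hε₁0 hε₁ (him' i₀) (hg'.maps i₀)).comp hε₁0 hε₁ hθ hθmaps).const_mul
    hε₁0 hε₁ (inv_pos.2 hσ)
  have hFu : ∀ m, (u 1)⁻¹ * ψ (g' i₀ (θ (u m))) = (u 1)⁻¹ * u (m + 1) := fun m => by
    rw [hθu, ← hv1, hψv]
  have hθ0 : θ 0 = 0 := by simpa [hψ0] using hθψ 0 h0
  obtain ⟨φ, φ₁, hφ, -, -, hφF⟩ := hF.exists_inverse hε₁0 hε₁
    (by rw [hθ0, hg'.first i₀ hi₀, hψ0, mul_zero])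
    ((hFu 0).trans (inv_mul_cancel₀ hσ.ne'))
  have hφu : ∀ m, φ ((u 1)⁻¹ * u (m + 1)) = u m := fun m => by rw [← hFu, hφF _ (huI m)]
  have hrel : ∀ m, a * u (m + 1) + b * u (m + 1) ^ (((n + 1 : ℕ) : ℝ) + ε) = u m := fun m => by
    rw [hu1]; exact hfirst _ (huI m)
  have hdecay : ∀ m, u m ≤ a⁻¹ ^ m := by
    intro m
    induction m with
    | zero => simp [hu]
    | succ m ih =>
      have h := hrel m
      have := mul_pos hb (Real.rpow_pos_of_pos (hupos (m + 1)) (((n + 1 : ℕ) : ℝ) + ε))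
      rw [pow_succ', inv_mul_eq_div, le_div_iff₀' (one_pos.trans ha)]
      linarith
  refine not_holderDiff_of_frequently_eq_rpow (n := n + 1) (ε := ε) (ε₁ := ε₁)
    (C := b * u 1 ^ (((n + 1 : ℕ) : ℝ) + ε)) (P := fun t => φ t + -(a * u 1) * t) hε hεε
    (mul_pos hb (Real.rpow_pos_of_pos hσ _)) (fun δ hδ => ?_)
    (hφ.holderDiff.add ((holderDiff_id hε₁).const_mul hε₁0 hε₁ _))
  obtain ⟨m, hm⟩ := exists_pow_lt_of_lt_one (mul_pos hσ hδ) (inv_lt_one_of_one_lt₀ ha)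
  have hule : u (m + 1) ≤ u m := by
    rw [← hrel m]
    have := Real.rpow_nonneg (hupos (m + 1)).le (((n + 1 : ℕ) : ℝ) + ε)
    nlinarith [hupos (m + 1)]
  have hpos := hupos (m + 1)
  refine ⟨(u 1)⁻¹ * u (m + 1), ⟨by positivity, ?_⟩, ?_⟩
  · rw [inv_mul_lt_iff₀ hσ]
    exact (hule.trans (hdecay m)).trans_lt hm
  · simp only [hφu]
    rw [mul_assoc b, ← Real.mul_rpow hσ.le (by positivity), mul_inv_cancel_left₀ hσ.ne', neg_mul,
      mul_assoc a, mul_inv_cancel_left₀ hσ.ne', ← hrel m]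
    ring

end CantorSystems

/-- Example: the inverse branches of
`f(x) = A((2d-1)x + x^{k+ε})` on `J₁` (with `A = (1 + (2d-1)^{-(k+ε)})⁻¹`) and the
increasing affine maps `J_i → [0,1]` (`i ≥ 2`) form a `C^{k+ε}` Cantor system whose scaling
function is not realized by any `C^{k+ε₁}` Cantor system for `ε < ε₁ ≤ 1`. -/
theorem stmt18 (d k : ℕ) (hd : 2 ≤ d) (hk : 1 ≤ k) (hkd : k < 2*d - 1)
    (ε : ℝ) (hε0 : 0 < ε) (hε1 : ε < 1)
    (g : Fin d → ℝ → ℝ)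
    (hmaps : ∀ i : Fin d, ∀ y ∈ I01,
      g i y ∈ Set.Icc ((2*(i:ℕ) : ℝ)/(2*(d:ℝ)-1)) ((2*(i:ℕ)+1 : ℝ)/(2*(d:ℝ)-1)))
    (hg0 : ∀ i : Fin d, (i:ℕ) = 0 → ∀ y ∈ I01,
      (1 + (2*(d:ℝ)-1) ^ (-((k:ℝ)+ε)))⁻¹
        * ((2*(d:ℝ)-1) * g i y + g i y ^ ((k:ℝ)+ε)) = y)
    (hgi : ∀ i : Fin d, 1 ≤ (i:ℕ) → ∀ y ∈ I01,
      g i y = (y + 2*(i:ℕ)) / (2*(d:ℝ)-1)) :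
    IsCantorSystem k ε g ∧
    ∃ S : (ℕ → Fin d) → Fin (2*d-1) → ℝ, HasScalingFunction g S ∧
      ∀ ε₁ : ℝ, ε < ε₁ → ε₁ ≤ 1 →
        ¬ ∃ g' : Fin d → ℝ → ℝ, IsCantorSystem k ε₁ g' ∧ HasScalingFunction g' S := by
  obtain ⟨n, rfl⟩ := Nat.exists_eq_add_of_le' hk
  have h0 : (0 : ℝ) ∈ I01 := left_mem_Icc.2 zero_le_one
  have h1 : (1 : ℝ) ∈ I01 := right_mem_Icc.2 zero_le_one
  have hd2 : (2 : ℝ) ≤ d := by exact_mod_cast hd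
  set e : ℝ := ((n + 1 : ℕ) : ℝ) + ε with he
  have he1 : 1 < e := by rw [he]; push_cast; linarith [n.cast_nonneg (α := ℝ)]
  have hc1 : 1 < 2 * (d : ℝ) - 1 := by linarith
  generalize hcdef : 2 * (d : ℝ) - 1 = c at *
  have hc0 : 0 < c := one_pos.trans hc1
  have hpow : 0 < c ^ (-e) := Real.rpow_pos_of_pos hc0 _
  have hpow1 : c ^ (-e) < 1 := Real.rpow_lt_one_of_one_lt_of_neg hc1 (by linarith)
  set A : ℝ := (1 + c ^ (-e))⁻¹ with hA
  have hA0 : 0 < A := by positivity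
  have hAc : 1 < A * c := by
    rw [hA, inv_mul_eq_div, one_lt_div (by positivity)]
    linarith
  have hfirst : ∀ i : Fin d, (i : ℕ) = 0 → ∀ y ∈ I01, A * c * g i y + A * g i y ^ e = y :=
    fun i hi y hy => by rw [mul_assoc, ← mul_add, hg0 i hi y hy]
  have hi2 : ∀ i : Fin d, 2 * ((i : ℕ) : ℝ) + 1 ≤ c := fun i => by
    have : (((i : ℕ) + 1 : ℕ) : ℝ) ≤ d := by exact_mod_cast i.isLt
    push_cast at this
    linarith
  have hI : ∀ i, MapsTo (g i) I01 I01 := fun i y hy =>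
    ⟨(div_nonneg (by positivity) hc0.le).trans (hmaps i y hy).1,
      (hmaps i y hy).2.trans ((div_le_one hc0).2 (hi2 i))⟩
  have hbranch : ∀ i, ∃ g₁, IsHolderImmersion ε n (g i) g₁ ∧ ∀ x ∈ I01, g₁ x < 1 := by
    intro i
    rcases Nat.eq_zero_or_pos (i : ℕ) with hi | hi
    · refine ⟨_, (isHolderImmersion_linear_add_rpow hε0 hε1.le (by positivity : 0 < A * c) hA0
        n).rightInverse hε0 hε1.le (hI i) (hfirst i hi), fun x hx => ?_⟩
      refine inv_lt_one_of_one_lt₀ (hAc.trans_le (le_add_of_nonneg_right ?_))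
      have := Real.rpow_nonneg (hI i hx).1 ((n : ℝ) + ε)
      positivity
    · refine ⟨fun _ => c⁻¹, ⟨fun x hx => ?_, fun _ _ => inv_pos.2 hc0, holderDiff_const _⟩,
        fun _ _ => inv_lt_one_of_one_lt₀ hc1⟩
      refine HasDerivWithinAt.congr (f := fun y => (y + 2 * (i : ℕ)) / c) ?_ (hgi i hi)
        (hgi i hi x hx)
      simpa using (((hasDerivWithinAt_id x I01).add_const (2 * ((i : ℕ) : ℝ))).div_const c)
  choose g₁ hg₁ hlt using hbranch
  have hsys : IsCantorSystem (n + 1) ε g := by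
    refine isCantorSystem_of_isHolderImmersion hε0 hg₁ hI hlt (fun i j hij => ?_) (fun i hi => ?_)
      fun i hi => ?_
    · refine (hmaps i 1 h1).2.trans_lt (lt_of_lt_of_le ?_ (hmaps j 0 h0).1)
      have : ((i : ℕ) : ℝ) + 1 ≤ (j : ℕ) := by exact_mod_cast hij
      gcongr
      linarith
    · have h := hfirst i hi 0 h0
      have hpos := (hI i h0).1
      have := Real.rpow_nonneg hpos e
      have h' : A * c * g i 0 ≤ 0 := by nlinarith
      exact le_antisymm (nonpos_of_mul_nonpos_right h' (by positivity)) hpos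
    · rw [hgi i (by omega) 1 h1, hi, Nat.cast_sub (by omega), div_eq_one_iff_eq hc0.ne', ← hcdef]
      push_cast
      ring
  obtain ⟨S, hS⟩ := hsys.exists_hasScalingFunction hε0 hε1.le
  refine ⟨hsys, S, hS, fun ε₁ hεε hε₁ => ?_⟩
  rintro ⟨g', hg', hS'⟩
  refine not_hasScalingFunction_of_smoother (i₀ := ⟨0, by omega⟩) (l := ⟨d - 1, by omega⟩)
    hε0 hεε hε₁ hsys hS rfl rfl hAc hA0 (inv_pos.2 hc0) (fun x hx y hy => ?_)
    (hfirst _ rfl) hg' hS'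
  have hd1 : 1 ≤ d - 1 := by omega
  rw [hgi _ hd1 x hx, hgi _ hd1 y hy]
  ring
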